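/- arXiv:1403.2528 — 2 statements merged into one kernel-verified Lean document; each statement's English description precedes it below -/
import Mathlib

section
/- Let m_i, m_e, ν_i, ν_e, T_i, T_e, e > 0, set μ₁ = (T_i+T_e)/(m_iν_i+m_eν_e), and assume the cubic g(λ) = λ³ + (ν_i+ν_e)λ² + (ν_iν_e + 4π(e²/m_i+e²/m_e))λ + 4π(e²ν_e/m_i+e²ν_i/m_e) has three distinct complex roots (its discriminant is nonzero). Then there exist constants r₀, C, λ > 0 such that for every k ∈ ℝ³ with 0 < |k| ≤ r₀ and every solution (ρ̂_i, ρ̂_e, û_i, û_e) of the Fourier-transformed longitudinal fluid system at frequency k, setting |Û_{∥0}|² = |ρ̂_i(0)|²+|ρ̂_e(0)|²+|û_i(0)|²+|û_e(0)|², ρ̄̂(t) = e^{−μ₁|k|²t}(m_iν_i ρ̂_i(0)+m_eν_e ρ̂_e(0))/(m_iν_i+m_eν_e), ū̂(t) = −μ₁ (i k) ρ̄̂(t), Ē̂(t) = ((T_im_eν_e−T_em_iν_i)/(e(m_iν_i+m_eν_e))) (i k) ρ̄̂(t), Ê_∥(t) = −4πe (i k/|k|²)(ρ̂_i(t)−ρ̂_e(t)),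 one has for all t ≥ 0 and α = i,e: |ρ̂_α(t) − ρ̄̂(t)| ≤ C|k|e^{−λ|k|²t}|Û_{∥0}| + Ce^{−λt}|Û_{∥0}|; |û_α(t) − ū̂(t)| ≤ C|k|²e^{−λ|k|²t}|Û_{∥0}| + Ce^{−λt}(|Û_{∥0}| + |Ê_∥(0)|); and |Ê_∥(t) − Ē̂(t)| ≤ C|k|²e^{−λ|k|²t}|Û_{∥0}| + Ce^{−λt}(|Û_{∥0}| + |Ê_∥(0)|). -/
open Real Complex

/-- Squared Hermitian norm on `ℂ³`. -/
noncomputable def hsq (v : Fin 3 → ℂ) : ℝ := ∑ j, Complex.normSq (v j)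

/-- Hermitian norm on `ℂ³`. -/
noncomputable def hnorm (v : Fin 3 → ℂ) : ℝ := Real.sqrt (hsq v)

theorem le_mul_exp_of_deriv_le {f f' : ℝ → ℝ} {a : ℝ}
    (hf : ∀ t, HasDerivAt f (f' t) t) (h : ∀ t, 0 ≤ t → f' t ≤ -a * f t)
    {t : ℝ} (ht : 0 ≤ t) : f t ≤ f 0 * Real.exp (-(a * t)) := by
  have hg : ∀ s, HasDerivAt (fun s => f s * Real.exp (a * s))
      (f' s * Real.exp (a * s) + f s * (Real.exp (a * s) * a)) s := by
    intro s
    have h1 : HasDerivAt (fun s : ℝ => a * s) a s := by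
      simpa using (hasDerivAt_id s).const_mul a
    exact (hf s).mul h1.exp
  have hanti : AntitoneOn (fun s => f s * Real.exp (a * s)) (Set.Ici 0) := by
    apply antitoneOn_of_deriv_nonpos (convex_Ici 0)
    · exact fun s _ => (hg s).continuousAt.continuousWithinAt
    · exact fun s _ => (hg s).differentiableAt.differentiableWithinAt
    · intro s hs
      rw [interior_Ici] at hs
      rw [(hg s).deriv]
      nlinarith [h s (le_of_lt hs), Real.exp_pos (a * s)]
  have := hanti (Set.mem_Ici.2 le_rfl) (Set.mem_Ici.2 ht) ht
  simp only [mul_zero, Real.exp_zero, mul_one] at this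
  rw [Real.exp_neg, ← div_eq_mul_inv, le_div_iff₀ (Real.exp_pos _)]
  exact this

theorem le_exp_add_exp_of_deriv_le {f f' : ℝ → ℝ} {a b s : ℝ} (ha : 0 < a) (hb : 0 ≤ b)
    (hs : s ≤ a / 2) (hf : ∀ t, HasDerivAt f (f' t) t)
    (h : ∀ t, 0 ≤ t → f' t ≤ -a * f t + b * Real.exp (-(s * t)))
    {t : ℝ} (ht : 0 ≤ t) :
    f t ≤ f 0 * Real.exp (-(a * t)) + 2 * b / a * Real.exp (-(s * t)) := by
  have hg : ∀ r, HasDerivAt (fun r => f r - 2 * b / a * Real.exp (-(s * r)))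
      (f' r - 2 * b / a * (Real.exp (-(s * r)) * (-s))) r := by
    intro r
    have h1 : HasDerivAt (fun r : ℝ => -(s * r)) (-s) r := by
      simpa using ((hasDerivAt_id r).const_mul s).fun_neg
    exact (hf r).sub (h1.exp.const_mul _)
  have h0 : 0 ≤ 2 * b / a := by positivity
  have key := le_mul_exp_of_deriv_le (a := a) hg (fun r hr => by
    have h2 := h r hr
    have h3 : 2 * b / a * a = 2 * b := by field_simp
    have h4 := mul_nonneg (mul_nonneg h0 (Real.exp_pos (-(s * r))).le) (sub_nonneg.2 hs)
    generalize Real.exp (-(s * r)) = E at *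
    generalize 2 * b / a = B at *
    linear_combination h2 + h4 - (E / 2) * h3) ht
  have h5 := mul_nonneg h0 (Real.exp_pos (-(a * t))).le
  simp only [mul_zero, neg_zero, Real.exp_zero, mul_one] at key
  linarith

theorem two_mul_le_mul_sq_add_sq_div {θ : ℝ} (hθ : 0 < θ) (u v : ℝ) :
    2 * (u * v) ≤ θ * u ^ 2 + v ^ 2 / θ := by
  have : θ * u ^ 2 + v ^ 2 / θ - 2 * (u * v) = (θ * u - v) ^ 2 / θ := by
    field_simp
    ring
  have : 0 ≤ (θ * u - v) ^ 2 / θ := by positivity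
  linarith

theorem exists_fast_lyapunov {a b ν η : ℝ} (ha : 0 < a) (hb : 0 < b) (hν : 0 < ν) (hη : 0 < η) :
    ∃ ε c c₁ c₂ B : ℝ, 0 < c ∧ 0 < c₁ ∧ 0 < c₂ ∧ 0 < B ∧ ∀ D x y : ℝ,
      c₁ * (D ^ 2 + x ^ 2 + y ^ 2) ≤ D ^ 2 + x ^ 2 / a + y ^ 2 / b - 2 * ε * (D * (x - y)) ∧
      D ^ 2 + x ^ 2 / a + y ^ 2 / b - 2 * ε * (D * (x - y)) ≤ c₂ * (D ^ 2 + x ^ 2 + y ^ 2) ∧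
      ∀ e₁ e₂ e₃ : ℝ,
        2 * D * (-(x - y) + e₁) + 2 * x * (a * D - ν * x + e₂) / a
          + 2 * y * (-b * D - η * y + e₃) / b
          - 2 * ε * ((-(x - y) + e₁) * (x - y)
            + D * ((a * D - ν * x + e₂) - (-b * D - η * y + e₃)))
          ≤ -c * (D ^ 2 + x ^ 2 + y ^ 2) + B * (e₁ ^ 2 + e₂ ^ 2 + e₃ ^ 2) := by
  obtain ⟨p, hp, hpa⟩ : ∃ p : ℝ, 0 < p ∧ p * a = 1 := ⟨a⁻¹, by positivity, by field_simp⟩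
  obtain ⟨q, hq, hqb⟩ : ∃ q : ℝ, 0 < q ∧ q * b = 1 := ⟨b⁻¹, by positivity, by field_simp⟩
  have hdp : ∀ z, z / a = z * p := fun z => by
    rw [div_eq_iff ha.ne', mul_assoc, hpa, mul_one]
  have hdq : ∀ z, z / b = z * q := fun z => by
    rw [div_eq_iff hb.ne', mul_assoc, hqb, mul_one]
  obtain ⟨ε, hε, hε1, hεp, hεq, hεx, hεy⟩ : ∃ ε : ℝ, 0 < ε ∧ ε ≤ 1 ∧ 8 * ε ≤ p ∧ 8 * ε ≤ q ∧
      ε * (2 * ν ^ 2 / (a + b) + 4) ≤ ν * p ∧ ε * (2 * η ^ 2 / (a + b) + 4) ≤ η * q := by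
    have h1 : 0 < 2 * ν ^ 2 / (a + b) + 4 := by positivity
    have h2 : 0 < 2 * η ^ 2 / (a + b) + 4 := by positivity
    refine ⟨min 1 (min (p / 8) (min (q / 8) (min (ν * p / (2 * ν ^ 2 / (a + b) + 4))
      (η * q / (2 * η ^ 2 / (a + b) + 4))))), by positivity, min_le_left _ _, ?_, ?_, ?_, ?_⟩
    · have : min 1 (min (p / 8) (min (q / 8) (min (ν * p / (2 * ν ^ 2 / (a + b) + 4))
        (η * q / (2 * η ^ 2 / (a + b) + 4))))) ≤ p / 8 := by simp
      linarith
    · have : min 1 (min (p / 8) (min (q / 8) (min (ν * p / (2 * ν ^ 2 / (a + b) + 4))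
        (η * q / (2 * η ^ 2 / (a + b) + 4))))) ≤ q / 8 := by simp
      linarith
    · rw [← le_div_iff₀ h1]; simp
    · rw [← le_div_iff₀ h2]; simp
  obtain ⟨c, hc, hcD, hcx, hcy⟩ : ∃ c : ℝ, 0 < c ∧ c ≤ ε * (a + b) ∧ c ≤ ν * p ∧ c ≤ η * q :=
    ⟨min (ε * (a + b)) (min (ν * p) (η * q)), by positivity, by simp, by simp, by simp⟩
  refine ⟨ε, c / 2, min (1 / 2) (min (p / 2) (q / 2)), 2 + p + q + 1,
    (2 + p ^ 2 + q ^ 2 + 1) * (3 * (6 / c)), by positivity, by positivity, by positivity,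
    by positivity, fun D x y => ?_⟩
  simp only [hdp, hdq]
  have hx := two_mul_le_mul_sq_add_sq_div (θ := 1 / 4) (by norm_num) D (ε * x)
  have hy := two_mul_le_mul_sq_add_sq_div (θ := 1 / 4) (by norm_num) D (-ε * y)
  have hx' := two_mul_le_mul_sq_add_sq_div (θ := 1 / 4) (by norm_num) D (-ε * x)
  have hy' := two_mul_le_mul_sq_add_sq_div (θ := 1 / 4) (by norm_num) D (ε * y)
  have hεε : ε ^ 2 ≤ ε := by nlinarith
  have hxp : 8 * ε ^ 2 * x ^ 2 ≤ p * x ^ 2 :=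
    mul_le_mul_of_nonneg_right (by linarith) (sq_nonneg _)
  have hyq : 8 * ε ^ 2 * y ^ 2 ≤ q * y ^ 2 :=
    mul_le_mul_of_nonneg_right (by linarith) (sq_nonneg _)
  have hD2 := sq_nonneg D
  have hx2 := sq_nonneg x
  have hy2 := sq_nonneg y
  refine ⟨?_, ?_, fun e₁ e₂ e₃ => ?_⟩
  · have h1 : min (1 / 2) (min (p / 2) (q / 2)) * D ^ 2 ≤ 1 / 2 * D ^ 2 :=
      mul_le_mul_of_nonneg_right (by simp) hD2
    have h2 : min (1 / 2) (min (p / 2) (q / 2)) * x ^ 2 ≤ p / 2 * x ^ 2 :=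
      mul_le_mul_of_nonneg_right (by simp) hx2
    have h3 : min (1 / 2) (min (p / 2) (q / 2)) * y ^ 2 ≤ q / 2 * y ^ 2 :=
      mul_le_mul_of_nonneg_right (by simp) hy2
    linarith
  · nlinarith [mul_nonneg hp.le hD2, mul_nonneg hp.le hy2, mul_nonneg hq.le hD2,
      mul_nonneg hq.le hx2]
  · have hab : 0 < (a + b) / 2 := by positivity
    have m1 := mul_le_mul_of_nonneg_left
      (two_mul_le_mul_sq_add_sq_div hab D (ν * x)) hε.le
    have m2 := mul_le_mul_of_nonneg_left
      (two_mul_le_mul_sq_add_sq_div hab D (-η * y)) hε.le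
    have m3 := mul_le_mul_of_nonneg_right hεx hx2
    have m4 := mul_le_mul_of_nonneg_right hεy hy2
    have m5 := mul_nonneg hε.le (sq_nonneg (x + y))
    have i1 : (ν * x) ^ 2 / ((a + b) / 2) = 2 * ν ^ 2 / (a + b) * x ^ 2 := by
      field_simp
    have i2 : (-η * y) ^ 2 / ((a + b) / 2) = 2 * η ^ 2 / (a + b) * y ^ 2 := by
      field_simp
    rw [i1] at m1
    rw [i2] at m2
    have main : -2 * (ν * p * x ^ 2 + η * q * y ^ 2) - 2 * ε * (a + b) * D ^ 2
        + 2 * ε * (D * (ν * x - η * y)) + 2 * ε * (x - y) ^ 2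
        ≤ -c * (D ^ 2 + x ^ 2 + y ^ 2) := by
      have n1 := mul_le_mul_of_nonneg_right hcD hD2
      have n2 := mul_le_mul_of_nonneg_right hcx hx2
      have n3 := mul_le_mul_of_nonneg_right hcy hy2
      linarith
    have hθ : 0 < c / 6 := by positivity
    have hi : ∀ v : ℝ, v / (c / 6) = 6 / c * v := fun v => by field_simp
    have err : 2 * (D * e₁) + 2 * (x * (-ε * e₁)) + 2 * (y * (ε * e₁)) + 2 * (x * (p * e₂))
        + 2 * (D * (-ε * e₂)) + 2 * (y * (q * e₃)) + 2 * (D * (ε * e₃))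
        ≤ c / 2 * (D ^ 2 + x ^ 2 + y ^ 2)
          + (2 + p ^ 2 + q ^ 2 + 1) * (3 * (6 / c)) * (e₁ ^ 2 + e₂ ^ 2 + e₃ ^ 2) := by
      have r1 := two_mul_le_mul_sq_add_sq_div hθ D e₁
      have r2 := two_mul_le_mul_sq_add_sq_div hθ x (-ε * e₁)
      have r3 := two_mul_le_mul_sq_add_sq_div hθ y (ε * e₁)
      have r4 := two_mul_le_mul_sq_add_sq_div hθ x (p * e₂)
      have r5 := two_mul_le_mul_sq_add_sq_div hθ D (-ε * e₂)
      have r6 := two_mul_le_mul_sq_add_sq_div hθ y (q * e₃)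
      have r7 := two_mul_le_mul_sq_add_sq_div hθ D (ε * e₃)
      rw [hi] at r1 r2 r3 r4 r5 r6 r7
      have s : 6 / c * (e₁ ^ 2 + (-ε * e₁) ^ 2 + (ε * e₁) ^ 2 + (p * e₂) ^ 2
          + (-ε * e₂) ^ 2 + (q * e₃) ^ 2 + (ε * e₃) ^ 2)
          ≤ 6 / c * (3 * (2 + p ^ 2 + q ^ 2 + 1) * (e₁ ^ 2 + e₂ ^ 2 + e₃ ^ 2)) := by
        apply mul_le_mul_of_nonneg_left _ (by positivity)
        have hεε1 : ε ^ 2 ≤ 1 := by linarith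
        have j1 := mul_le_mul_of_nonneg_right hεε1 (sq_nonneg e₁)
        have j2 := mul_le_mul_of_nonneg_right hεε1 (sq_nonneg e₂)
        have j3 := mul_le_mul_of_nonneg_right hεε1 (sq_nonneg e₃)
        have k1 := mul_nonneg (sq_nonneg p) (sq_nonneg e₁)
        have k2 := mul_nonneg (sq_nonneg p) (sq_nonneg e₂)
        have k3 := mul_nonneg (sq_nonneg p) (sq_nonneg e₃)
        have k4 := mul_nonneg (sq_nonneg q) (sq_nonneg e₁)
        have k5 := mul_nonneg (sq_nonneg q) (sq_nonneg e₂)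
        have k6 := mul_nonneg (sq_nonneg q) (sq_nonneg e₃)
        linarith [sq_nonneg e₁, sq_nonneg e₂, sq_nonneg e₃]
      have hy2' : 0 ≤ c * D ^ 2 := by positivity
      have hx2' : 0 ≤ c * x ^ 2 := by positivity
      have hz2' : 0 ≤ c * y ^ 2 := by positivity
      linarith
    linear_combination main + err + 2 * x * D * hpa - 2 * y * D * hqb

set_option maxHeartbeats 1000000 in
theorem exists_slow_fast_decay {μ a b ν η C₀ : ℝ} (hμ : 0 < μ) (ha : 0 < a) (hb : 0 < b)
    (hν : 0 < ν) (hη : 0 < η) (hC₀ : 0 < C₀) :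
    ∃ r₀ C lam : ℝ, 0 < r₀ ∧ r₀ ≤ 1 ∧ 0 < C ∧ 0 < lam ∧ ∀ K : ℝ, 0 < K → K ≤ r₀ →
      ∀ S δ z₁ z₂ z₃ eS e₁ e₂ e₃ : ℝ → ℝ,
      (∀ t, HasDerivAt S (-(μ * K ^ 2) * S t + eS t) t) →
      (∀ t, HasDerivAt δ (-(μ * K ^ 2) * δ t + eS t) t) →
      (∀ t, HasDerivAt z₁ (-(z₂ t - z₃ t) + e₁ t) t) →
      (∀ t, HasDerivAt z₂ (a * z₁ t - ν * z₂ t + e₂ t) t) →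
      (∀ t, HasDerivAt z₃ (-b * z₁ t - η * z₃ t + e₃ t) t) →
      (∀ t, eS t ^ 2 ≤ C₀ * K ^ 6 * (z₁ t ^ 2 + z₂ t ^ 2 + z₃ t ^ 2 + K ^ 2 * S t ^ 2)) →
      (∀ t, e₁ t ^ 2 + e₂ t ^ 2 + e₃ t ^ 2
        ≤ C₀ * K ^ 4 * (z₁ t ^ 2 + z₂ t ^ 2 + z₃ t ^ 2 + K ^ 2 * S t ^ 2)) →
      ∀ t, 0 ≤ t →
        δ t ^ 2 + K ^ 2 * S t ^ 2 ≤ C * (δ 0 ^ 2 + K ^ 2 * S 0 ^ 2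
          + K ^ 4 * (z₁ 0 ^ 2 + z₂ 0 ^ 2 + z₃ 0 ^ 2)) * Real.exp (-(lam * K ^ 2 * t)) ∧
        z₁ t ^ 2 + z₂ t ^ 2 + z₃ t ^ 2 ≤
          C * ((z₁ 0 ^ 2 + z₂ 0 ^ 2 + z₃ 0 ^ 2) * Real.exp (-(lam * t))
            + K ^ 4 * (δ 0 ^ 2 + K ^ 2 * S 0 ^ 2
              + K ^ 4 * (z₁ 0 ^ 2 + z₂ 0 ^ 2 + z₃ 0 ^ 2)) * Real.exp (-(lam * K ^ 2 * t))) := by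
  obtain ⟨ε, c, c₁, c₂, B, hc, hc₁, hc₂, hB, hW⟩ := exists_fast_lyapunov ha hb hν hη
  obtain ⟨C₁, hC₁, hC₁def⟩ : ∃ C₁ : ℝ, 0 < C₁ ∧ C₁ = B * C₀ := ⟨_, by positivity, rfl⟩
  obtain ⟨C₂, hC₂, hC₂def⟩ : ∃ C₂ : ℝ, 0 < C₂ ∧ μ * C₂ = C₀ :=
    ⟨C₀ / μ, by positivity, by field_simp⟩
  obtain ⟨A, hA, hAc⟩ : ∃ A : ℝ, 0 < A ∧ A * c = 2 * C₂ + 1 :=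
    ⟨(2 * C₂ + 1) / c, by positivity, by field_simp⟩
  obtain ⟨γ, hγ, hγc⟩ : ∃ γ : ℝ, 0 < γ ∧ γ * c₂ = c / 2 :=
    ⟨c / 2 / c₂, by positivity, by field_simp⟩
  obtain ⟨lam, hlam, hlamμ, hlamγ, hlamA⟩ : ∃ lam : ℝ, 0 < lam ∧ lam ≤ μ / 2 ∧ lam ≤ γ / 2 ∧
      lam * (A * c₂) ≤ 1 / 2 := by
    refine ⟨min (μ / 2) (min (γ / 2) (1 / 2 / (A * c₂))), by positivity, by simp, by simp, ?_⟩
    rw [← le_div_iff₀ (by positivity)]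
    simp
  obtain ⟨r₀, hr₀, hr1, hrμ, hrA, hrc⟩ : ∃ r₀ : ℝ, 0 < r₀ ∧ r₀ ≤ 1 ∧
      r₀ * (2 * C₂ + A * C₁) ≤ μ / 2 ∧ r₀ * (A * C₁) ≤ 1 / 2 ∧ r₀ * C₁ ≤ c / 2 := by
    refine ⟨min 1 (min (μ / 2 / (2 * C₂ + A * C₁)) (min (1 / 2 / (A * C₁)) (c / 2 / C₁))),
      by positivity, by simp, ?_, ?_, ?_⟩ <;>
    · rw [← le_div_iff₀ (by positivity)]
      simp
  refine ⟨r₀, (1 + A * c₂) + (c₂ + 2 * C₁ / γ * (1 + A * c₂)) / c₁, lam, hr₀, hr1,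
    by positivity, hlam, ?_⟩
  intro K hK hKr S δ z₁ z₂ z₃ eS e₁ e₂ e₃ hS hδ h₁ h₂ h₃ heS he
  have hK1 : K ≤ 1 := hKr.trans hr1
  have hK2 : K ^ 2 ≤ r₀ := by nlinarith
  have hK21 : K ^ 2 ≤ 1 := hK2.trans hr1
  have hK2p : 0 < K ^ 2 := by positivity
  have hK4 : K ^ 4 ≤ K ^ 2 := by nlinarith
  have hK42 : K ^ 4 ≤ r₀ := hK4.trans hK2
  have hK6 : K ^ 6 ≤ K ^ 2 := by nlinarith
  have hK62 : K ^ 6 ≤ r₀ := hK6.trans hK2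
  have hK2μ : K ^ 2 * (2 * C₂) + K ^ 6 * (A * C₁) ≤ μ / 2 := by
    have := mul_le_mul_of_nonneg_right hK2 (show 0 ≤ 2 * C₂ by positivity)
    have := mul_le_mul_of_nonneg_right hK62 (show 0 ≤ A * C₁ by positivity)
    linarith
  set n : ℝ → ℝ := fun t => z₁ t ^ 2 + z₂ t ^ 2 + z₃ t ^ 2 with hn
  set W : ℝ → ℝ := fun t => z₁ t ^ 2 + z₂ t ^ 2 / a + z₃ t ^ 2 / b
    - 2 * ε * (z₁ t * (z₂ t - z₃ t)) with hWdef
  have hn0 : ∀ t, 0 ≤ n t := fun t => by positivity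
  have hWl : ∀ t, c₁ * n t ≤ W t := fun t => (hW _ _ _).1
  have hWu : ∀ t, W t ≤ c₂ * n t := fun t => (hW _ _ _).2.1
  obtain ⟨W', hW', hW'le⟩ : ∃ W' : ℝ → ℝ, (∀ t, HasDerivAt W (W' t) t) ∧
      ∀ t, W' t ≤ -c * n t + C₁ * K ^ 4 * (n t + K ^ 2 * S t ^ 2) := by
    refine ⟨_, fun t => (((((h₁ t).fun_pow 2).fun_add (((h₂ t).fun_pow 2).div_const a)).fun_add
      (((h₃ t).fun_pow 2).div_const b)).fun_sub
      (((h₁ t).fun_mul ((h₂ t).fun_sub (h₃ t))).const_mul (2 * ε))), fun t => ?_⟩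
    have h := (hW (z₁ t) (z₂ t) (z₃ t)).2.2 (e₁ t) (e₂ t) (e₃ t)
    have h' := mul_le_mul_of_nonneg_left (he t) hB.le
    have h'' : B * (C₀ * K ^ 4 * (n t + K ^ 2 * S t ^ 2))
      = C₁ * K ^ 4 * (n t + K ^ 2 * S t ^ 2) := by rw [hC₁def]; ring
    refine le_trans (le_of_eq ?_) (h.trans ((add_le_add_right h' _).trans (le_of_eq ?_)))
    · norm_num
    · rw [← h'']
  have hyoung : ∀ (f : ℝ → ℝ) t, 2 * (f t * eS t) ≤
      μ * K ^ 2 * f t ^ 2 + C₂ * K ^ 4 * (n t + K ^ 2 * S t ^ 2) := by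
    intro f t
    have h := two_mul_le_mul_sq_add_sq_div (θ := μ * K ^ 2) (by positivity) (f t) (eS t)
    have h' : eS t ^ 2 / (μ * K ^ 2) ≤ C₂ * K ^ 4 * (n t + K ^ 2 * S t ^ 2) := by
      rw [div_le_iff₀ (by positivity)]
      refine (heS t).trans (le_of_eq ?_)
      rw [← hC₂def]
      ring
    linarith
  set F : ℝ → ℝ := fun t => δ t ^ 2 + K ^ 2 * S t ^ 2 + A * K ^ 4 * W t with hF
  have hFder := fun t => (((hδ t).fun_pow 2).fun_add (((hS t).fun_pow 2).const_mul (K ^ 2))).fun_add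
    ((hW' t).const_mul (A * K ^ 4))
  have hFdecay : ∀ t, 0 ≤ t → F t ≤ F 0 * Real.exp (-(lam * K ^ 2 * t)) := by
    intro t ht
    refine le_mul_exp_of_deriv_le hFder (fun s _ => ?_) ht
    have q1 := hyoung δ s
    have q2 := mul_le_mul_of_nonneg_left (hyoung S s) hK2p.le
    have q3 := mul_le_mul_of_nonneg_left (hW'le s) (show 0 ≤ A * K ^ 4 by positivity)
    have q4 := mul_le_mul_of_nonneg_left (hWu s) (show 0 ≤ lam * K ^ 2 * (A * K ^ 4) by positivity)
    have ns := hn0 s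
    have p1 := mul_le_mul_of_nonneg_right hK2μ (show 0 ≤ K ^ 4 * S s ^ 2 by positivity)
    have p2 := mul_le_mul_of_nonneg_right hlamμ (show 0 ≤ K ^ 2 * δ s ^ 2 by positivity)
    have p3 := mul_le_mul_of_nonneg_right hlamμ (show 0 ≤ K ^ 4 * S s ^ 2 by positivity)
    have p4 := mul_le_mul_of_nonneg_right hlamA (show 0 ≤ K ^ 6 * n s by positivity)
    have p5 := mul_le_mul_of_nonneg_right hK21 (show 0 ≤ K ^ 4 * n s by positivity)
    have p6 := mul_le_mul_of_nonneg_right hK42 (show 0 ≤ A * C₁ * (K ^ 4 * n s) by positivity)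
    have p7 := mul_le_mul_of_nonneg_right hrA (show 0 ≤ K ^ 4 * n s by positivity)
    have p8 := mul_le_mul_of_nonneg_right hK21 (show 0 ≤ C₂ * (K ^ 4 * n s) by positivity)
    have p9 := mul_le_mul_of_nonneg_right hK21 (show 0 ≤ C₂ * (K ^ 6 * S s ^ 2) by positivity)
    have p10 : 0 ≤ μ / 2 * (K ^ 2 * δ s ^ 2) := by positivity
    norm_num
    linear_combination q1 + q2 + q3 + q4 + p1 + p2 + p3 + p4 + p5 / 2 + p6 + p7 + p8 + p9 + p10
      - K ^ 4 * n s * hAc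
  have hF0 : F 0 ≤ (1 + A * c₂) * (δ 0 ^ 2 + K ^ 2 * S 0 ^ 2 + K ^ 4 * n 0) := by
    have q := mul_le_mul_of_nonneg_left (hWu 0) (show 0 ≤ A * K ^ 4 by positivity)
    have := hn0 0
    have : 0 ≤ A * c₂ * (δ 0 ^ 2 + K ^ 2 * S 0 ^ 2) := by positivity
    have : 0 ≤ K ^ 4 * n 0 := by positivity
    rw [show F 0 = δ 0 ^ 2 + K ^ 2 * S 0 ^ 2 + A * K ^ 4 * W 0 from rfl]
    linarith
  have hF0' : 0 ≤ δ 0 ^ 2 + K ^ 2 * S 0 ^ 2 + K ^ 4 * n 0 := by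
    have := hn0 0
    positivity
  have hWnn : ∀ t, 0 ≤ W t := fun t => le_trans (mul_nonneg hc₁.le (hn0 t)) (hWl t)
  have hSF : ∀ t, δ t ^ 2 + K ^ 2 * S t ^ 2 ≤ F t := fun t => by
    have := hWnn t
    have : 0 ≤ A * K ^ 4 * W t := by positivity
    rw [show F t = δ t ^ 2 + K ^ 2 * S t ^ 2 + A * K ^ 4 * W t from rfl]
    linarith
  set Φ := δ 0 ^ 2 + K ^ 2 * S 0 ^ 2 + K ^ 4 * n 0 with hΦ
  intro t ht
  have hW1 := le_exp_add_exp_of_deriv_le (f := W) (f' := W') (a := γ)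
    (b := C₁ * K ^ 4 * ((1 + A * c₂) * Φ)) (s := lam * K ^ 2) hγ (by positivity) (by nlinarith) hW'
    (fun s hs => by
      have q1 := hW'le s
      have q2 := mul_le_mul_of_nonneg_left (hWu s) hγ.le
      have q3 : K ^ 2 * S s ^ 2 ≤ (1 + A * c₂) * Φ * Real.exp (-(lam * K ^ 2 * s)) := by
        have := (hSF s).trans ((hFdecay s hs).trans
          (mul_le_mul_of_nonneg_right hF0 (Real.exp_pos _).le))
        linarith [sq_nonneg (δ s)]
      have q4 := mul_le_mul_of_nonneg_left q3 (show 0 ≤ C₁ * K ^ 4 by positivity)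
      have q5 := mul_le_mul_of_nonneg_right hK42 (show 0 ≤ C₁ * n s from mul_nonneg hC₁.le (hn0 s))
      have q6 := mul_le_mul_of_nonneg_right hrc (hn0 s)
      linear_combination q1 + q2 + q4 + q5 + q6 + n s * hγc) ht
  have hE := Real.exp_pos (-(lam * K ^ 2 * t))
  have hE' := Real.exp_pos (-(lam * t))
  constructor
  · refine (hSF t).trans ((hFdecay t ht).trans (mul_le_mul_of_nonneg_right (hF0.trans ?_) hE.le))
    refine mul_le_mul_of_nonneg_right ?_ hF0'
    have : 0 ≤ (c₂ + 2 * C₁ / γ * (1 + A * c₂)) / c₁ := by positivity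
    linarith
  · have hEE : Real.exp (-(γ * t)) ≤ Real.exp (-(lam * t)) :=
      Real.exp_le_exp.2 (by nlinarith)
    have q1 : W 0 * Real.exp (-(γ * t)) ≤ c₂ * n 0 * Real.exp (-(lam * t)) :=
      mul_le_mul (hWu 0) hEE (Real.exp_pos _).le (mul_nonneg hc₂.le (hn0 0))
    have q2 : c₁ * n t ≤ (c₂ + 2 * C₁ / γ * (1 + A * c₂)) *
        (n 0 * Real.exp (-(lam * t)) + K ^ 4 * Φ * Real.exp (-(lam * K ^ 2 * t))) := by
      have e1 : 2 * (C₁ * K ^ 4 * ((1 + A * c₂) * Φ)) / γ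
        = 2 * C₁ / γ * (1 + A * c₂) * (K ^ 4 * Φ) := by ring
      rw [e1] at hW1
      have g1 : 0 ≤ 2 * C₁ / γ * (1 + A * c₂) * (n 0 * Real.exp (-(lam * t))) :=
        mul_nonneg (by positivity) (mul_nonneg (hn0 0) hE'.le)
      have g2 : 0 ≤ c₂ * (K ^ 4 * Φ * Real.exp (-(lam * K ^ 2 * t))) := by positivity
      linarith [hWl t]
    have q3 : n t ≤ (c₂ + 2 * C₁ / γ * (1 + A * c₂)) / c₁ *
        (n 0 * Real.exp (-(lam * t)) + K ^ 4 * Φ * Real.exp (-(lam * K ^ 2 * t))) := by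
      rw [div_mul_eq_mul_div, le_div_iff₀ hc₁]
      linarith
    have q4 : 0 ≤ n 0 * Real.exp (-(lam * t)) + K ^ 4 * Φ * Real.exp (-(lam * K ^ 2 * t)) := by
      have := mul_nonneg (hn0 0) hE'.le
      positivity
    refine q3.trans (mul_le_mul_of_nonneg_right ?_ q4)
    have : 0 < A * c₂ := by positivity
    linarith

theorem sq_linear_le (c₁ c₂ c₃ c₄ y₁ y₂ y₃ y₄ : ℝ) :
    (c₁ * y₁ + c₂ * y₂ + c₃ * y₃ + c₄ * y₄) ^ 2
      ≤ (c₁ ^ 2 + c₂ ^ 2 + c₃ ^ 2 + c₄ ^ 2) * (y₁ ^ 2 + y₂ ^ 2 + y₃ ^ 2 + y₄ ^ 2) := by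
  linarith [sq_nonneg (c₁ * y₂ - c₂ * y₁), sq_nonneg (c₁ * y₃ - c₃ * y₁),
    sq_nonneg (c₁ * y₄ - c₄ * y₁), sq_nonneg (c₂ * y₃ - c₃ * y₂),
    sq_nonneg (c₂ * y₄ - c₄ * y₂), sq_nonneg (c₃ * y₄ - c₄ * y₃)]

theorem exists_sq_linear_add_le (c₁ c₂ c₃ c₄ d₁ d₂ d₃ d₄ : ℝ) :
    ∃ C : ℝ, 0 < C ∧ ∀ s : ℝ, 0 ≤ s → s ≤ 1 → ∀ y₁ y₂ y₃ y₄ : ℝ,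
      (c₁ * y₁ + c₂ * y₂ + c₃ * y₃ + c₄ * y₄
        + s * (d₁ * y₁ + d₂ * y₂ + d₃ * y₃ + d₄ * y₄)) ^ 2
      ≤ C * (y₁ ^ 2 + y₂ ^ 2 + y₃ ^ 2 + y₄ ^ 2) := by
  refine ⟨2 * (c₁ ^ 2 + c₂ ^ 2 + c₃ ^ 2 + c₄ ^ 2) + 2 * (d₁ ^ 2 + d₂ ^ 2 + d₃ ^ 2 + d₄ ^ 2) + 1,
    by positivity, fun s hs hs1 y₁ y₂ y₃ y₄ => ?_⟩
  have hc := sq_linear_le c₁ c₂ c₃ c₄ y₁ y₂ y₃ y₄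
  have hd := sq_linear_le d₁ d₂ d₃ d₄ y₁ y₂ y₃ y₄
  have hy : 0 ≤ y₁ ^ 2 + y₂ ^ 2 + y₃ ^ 2 + y₄ ^ 2 := by positivity
  generalize c₁ * y₁ + c₂ * y₂ + c₃ * y₃ + c₄ * y₄ = u at *
  generalize d₁ * y₁ + d₂ * y₂ + d₃ * y₃ + d₄ * y₄ = v at *
  have h1 : s ^ 2 * v ^ 2 ≤ 1 * v ^ 2 :=
    mul_le_mul_of_nonneg_right (by nlinarith) (sq_nonneg v)
  linarith [sq_nonneg (u - s * v)]

set_option maxHeartbeats 1000000 in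
theorem exists_real_system_decay {mi me νi νe Ti Te κ M μ d : ℝ}
    (hmi : 0 < mi) (hme : 0 < me) (hνi : 0 < νi) (hνe : 0 < νe)
    (hTi : 0 < Ti) (hTe : 0 < Te) (hκ : 0 < κ) (hM : M = mi * νi + me * νe)
    (hμ : μ * M = Ti + Te) (hd : d * (κ * M) = Te * (mi * νi) - Ti * (me * νe)) :
    ∃ r₀ C lam : ℝ, 0 < r₀ ∧ 0 < C ∧ 0 < lam ∧ ∀ K : ℝ, 0 < K → K ≤ r₀ →
      ∀ ρi ρe x y : ℝ → ℝ,
      (∀ t, HasDerivAt ρi (-(K * x t)) t) →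
      (∀ t, HasDerivAt ρe (-(K * y t)) t) →
      (∀ t, HasDerivAt x (Ti / mi * K * ρi t + κ / mi * ((ρi t - ρe t) / K) - νi * x t) t) →
      (∀ t, HasDerivAt y (Te / me * K * ρe t + κ / me * ((ρe t - ρi t) / K) - νe * y t) t) →
      ∀ r : ℝ → ℝ, (∀ t, r t = Real.exp (-(μ * K ^ 2 * t)) *
        ((mi * νi * ρi 0 + me * νe * ρe 0) / M)) →
      ∀ U G : ℝ, U = ρi 0 ^ 2 + ρe 0 ^ 2 + x 0 ^ 2 + y 0 ^ 2 → G = ((ρi 0 - ρe 0) / K) ^ 2 →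
      ∀ t, 0 ≤ t →
        (ρi t - r t) ^ 2 ≤
          C * (K ^ 2 * Real.exp (-(lam * K ^ 2 * t)) * U + Real.exp (-(lam * t)) * U) ∧
        (ρe t - r t) ^ 2 ≤
          C * (K ^ 2 * Real.exp (-(lam * K ^ 2 * t)) * U + Real.exp (-(lam * t)) * U) ∧
        (x t - μ * K * r t) ^ 2 ≤
          C * (K ^ 4 * Real.exp (-(lam * K ^ 2 * t)) * U + Real.exp (-(lam * t)) * (U + G)) ∧
        (y t - μ * K * r t) ^ 2 ≤
          C * (K ^ 4 * Real.exp (-(lam * K ^ 2 * t)) * U + Real.exp (-(lam * t)) * (U + G)) ∧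
        ((ρi t - ρe t) / K - d * K * r t) ^ 2 ≤
          C * (K ^ 4 * Real.exp (-(lam * K ^ 2 * t)) * U + Real.exp (-(lam * t)) * (U + G)) := by
  have hM0 : 0 < M := by rw [hM]; positivity
  have hμ0 : 0 < μ := by
    rcases lt_or_ge 0 μ with h | h
    · exact h
    · nlinarith [mul_nonneg (neg_nonneg.2 h) hM0.le]
  have hdi : Ti / mi + κ / mi * d - νi * μ = 0 := by
    field_simp
    rw [← mul_left_inj' hM0.ne']
    linear_combination hd - νi * mi * hμ + Ti * hM
  have hde : Te / me - κ / me * d - νe * μ = 0 := by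
    field_simp
    rw [← mul_left_inj' hM0.ne']
    linear_combination -hd - νe * me * hμ + Te * hM
  obtain ⟨g, hg⟩ : ∃ g, g = (Ti * (me * νe) - Te * (mi * νi)) / M ^ 2 := ⟨_, rfl⟩
  obtain ⟨be, hbe⟩ : ∃ be, be = me * νe / M := ⟨_, rfl⟩
  obtain ⟨bi, hbi⟩ : ∃ bi, bi = mi * νi / M := ⟨_, rfl⟩
  obtain ⟨C₁, hC₁, hL⟩ := exists_sq_linear_add_le g (μ * mi / M) (μ * me / M)
    (g * d + μ ^ 2 * (mi + me) / M) 0 0 0 0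
  obtain ⟨C₂, hC₂, h₁⟩ := exists_sq_linear_add_le 0 0 0 (d * μ) (d * g) (d * (μ * mi / M))
    (d * (μ * me / M)) (d * (g * d + μ ^ 2 * (mi + me) / M))
  obtain ⟨C₃, hC₃, h₂⟩ := exists_sq_linear_add_le (Ti / mi * be) (Ti / M) (Ti / mi * me / M)
    (Ti / mi * (be * d + μ * (mi + me) / M) + μ ^ 2) (μ * g) (μ * (μ * mi / M))
    (μ * (μ * me / M)) (μ * (g * d + μ ^ 2 * (mi + me) / M))
  obtain ⟨C₄, hC₄, h₃⟩ := exists_sq_linear_add_le (-(Te / me * bi)) (Te / me * mi / M) (Te / M)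
    (Te / me * (-(bi * d) + μ * (mi + me) / M) + μ ^ 2) (μ * g) (μ * (μ * mi / M))
    (μ * (μ * me / M)) (μ * (g * d + μ ^ 2 * (mi + me) / M))
  obtain ⟨C₅, hC₅, hρi'⟩ := exists_sq_linear_add_le be (mi / M) (me / M)
    (be * d + μ * (mi + me) / M) 0 0 0 0
  obtain ⟨C₆, hC₆, hρe'⟩ := exists_sq_linear_add_le (-bi) (mi / M) (me / M)
    (-(bi * d) + μ * (mi + me) / M) 0 0 0 0
  obtain ⟨C₇, hC₇, hS0⟩ := exists_sq_linear_add_le (mi * νi / M) (me * νe / M) 0 0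
    0 0 (-mi / M) (-me / M)
  obtain ⟨C₈, hC₈, hδ0⟩ := exists_sq_linear_add_le 0 0 (-mi / M) (-me / M) 0 0 0 0
  obtain ⟨r₀, C, lam, hr₀, hr1, hC, hlam, key⟩ := exists_slow_fast_decay (μ := μ)
    (a := κ / mi) (b := κ / me) (ν := νi) (η := νe) (C₀ := C₁ + C₂ + C₃ + C₄) hμ0
    (by positivity) (by positivity) hνi hνe (by positivity)
  obtain ⟨B, hB, hBdef⟩ : ∃ B : ℝ, 0 < B ∧ B = 6 + 2 * (d ^ 2 + 2 * μ ^ 2 + 1) * C₇ + C₈ :=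
    ⟨_, by positivity, rfl⟩
  refine ⟨r₀, (2 + 2 * (C₅ + C₆) + 2 * μ ^ 2 + 2 * d ^ 2) * (C * (2 * B)), lam, hr₀,
    by positivity, hlam, ?_⟩
  intro K hK hKr ρi ρe x y hρi hρe hx hy r hr U G hU hG
  have hK1 : K ≤ 1 := hKr.trans hr1
  have hK21 : K ^ 2 ≤ 1 := by nlinarith
  have hK20 : 0 ≤ K ^ 2 := by positivity
  obtain ⟨S, hS⟩ : ∃ S : ℝ → ℝ, S = fun t =>
    (mi * νi * ρi t + me * νe * ρe t - K * (mi * x t + me * y t)) / M := ⟨_, rfl⟩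
  obtain ⟨δ, hδ⟩ : ∃ δ : ℝ → ℝ, δ = fun t => S t - r t := ⟨_, rfl⟩
  obtain ⟨z₁, hz₁⟩ : ∃ z : ℝ → ℝ, z = fun t => (ρi t - ρe t) / K - d * K * S t := ⟨_, rfl⟩
  obtain ⟨z₂, hz₂⟩ : ∃ z : ℝ → ℝ, z = fun t => x t - μ * K * S t := ⟨_, rfl⟩
  obtain ⟨z₃, hz₃⟩ : ∃ z : ℝ → ℝ, z = fun t => y t - μ * K * S t := ⟨_, rfl⟩
  obtain ⟨L, hLdef⟩ : ∃ L : ℝ → ℝ, L = fun t => g * z₁ t + μ * mi / M * z₂ t + μ * me / M * z₃ t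
    + (g * d + μ ^ 2 * (mi + me) / M) * (K * S t) := ⟨_, rfl⟩
  have hLeq : ∀ t, L t = μ * (mi * x t + me * y t) / M + g * ((ρi t - ρe t) / K) := by
    intro t
    simp only [hLdef, hz₁, hz₂, hz₃]
    ring
  have hρi_eq : ∀ t, ρi t = S t + K * (be * z₁ t + mi / M * z₂ t + me / M * z₃ t
      + (be * d + μ * (mi + me) / M) * (K * S t)) := by
    intro t
    have e1 : be * z₁ t + mi / M * z₂ t + me / M * z₃ t
      + (be * d + μ * (mi + me) / M) * (K * S t)
      = (mi * x t + me * y t) / M + be * ((ρi t - ρe t) / K) := by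
      simp only [hz₁, hz₂, hz₃]
      ring
    rw [e1, hS, hbe]
    field_simp
    linear_combination ρi t * hM
  have hρe_eq : ∀ t, ρe t = S t + K * (-bi * z₁ t + mi / M * z₂ t + me / M * z₃ t
      + (-(bi * d) + μ * (mi + me) / M) * (K * S t)) := by
    intro t
    have e1 : -bi * z₁ t + mi / M * z₂ t + me / M * z₃ t
      + (-(bi * d) + μ * (mi + me) / M) * (K * S t)
      = (mi * x t + me * y t) / M - bi * ((ρi t - ρe t) / K) := by
      simp only [hz₁, hz₂, hz₃]
      ring
    rw [e1, hS, hbi]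
    field_simp
    linear_combination ρe t * hM
  have hSder : ∀ t, HasDerivAt S (-(μ * K ^ 2) * S t + -K ^ 3 * L t) t := by
    intro t
    have h := (((((hρi t).const_mul (mi * νi)).fun_add ((hρe t).const_mul (me * νe))).fun_sub
      ((((hx t).const_mul mi).fun_add ((hy t).const_mul me)).const_mul K))).div_const M
    rw [← hS] at h
    refine h.congr_deriv ?_
    rw [hLeq, hg, hS]
    have hμ' : μ = (Ti + Te) / M := by rw [← hμ]; field_simp
    rw [hμ']
    field_simp
    rw [hM]
    ring
  have hrder : ∀ t, HasDerivAt r (-(μ * K ^ 2) * r t) t := by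
    intro t
    have h1 : HasDerivAt (fun s : ℝ => -(μ * K ^ 2 * s)) (-(μ * K ^ 2)) t := by
      simpa using ((hasDerivAt_id t).const_mul (μ * K ^ 2)).fun_neg
    have h2 := h1.exp.mul_const ((mi * νi * ρi 0 + me * νe * ρe 0) / M)
    rw [← funext hr] at h2
    refine h2.congr_deriv ?_
    rw [hr]
    ring
  have hδder : ∀ t, HasDerivAt δ (-(μ * K ^ 2) * δ t + -K ^ 3 * L t) t := by
    intro t
    have h := (hSder t).fun_sub (hrder t)
    rw [← hδ] at h
    refine h.congr_deriv ?_
    rw [hδ]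
    ring
  have hz₁der : ∀ t, HasDerivAt z₁ (-(z₂ t - z₃ t)
      + K ^ 2 * (d * μ * (K * S t) + K ^ 2 * (d * L t))) t := by
    intro t
    have h := (((hρi t).fun_sub (hρe t)).div_const K).fun_sub ((hSder t).const_mul (d * K))
    rw [← hz₁] at h
    refine h.congr_deriv ?_
    rw [hz₂, hz₃]
    field_simp
    ring
  have hz₂der : ∀ t, HasDerivAt z₂ (κ / mi * z₁ t - νi * z₂ t
      + K ^ 2 * (Ti / mi * (be * z₁ t + mi / M * z₂ t + me / M * z₃ t
        + (be * d + μ * (mi + me) / M) * (K * S t)) + μ ^ 2 * (K * S t)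
        + K ^ 2 * (μ * L t))) t := by
    intro t
    have h := (hx t).fun_sub ((hSder t).const_mul (μ * K))
    rw [← hz₂] at h
    refine h.congr_deriv ?_
    have e1 : (ρi t - ρe t) / K = z₁ t + d * K * S t := by rw [hz₁]; ring
    have e2 : x t = z₂ t + μ * K * S t := by rw [hz₂]; ring
    rw [e1, e2]
    linear_combination (Ti / mi * K) * hρi_eq t + K * S t * hdi
  have hz₃der : ∀ t, HasDerivAt z₃ (-(κ / me) * z₁ t - νe * z₃ t
      + K ^ 2 * (Te / me * (-bi * z₁ t + mi / M * z₂ t + me / M * z₃ t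
        + (-(bi * d) + μ * (mi + me) / M) * (K * S t)) + μ ^ 2 * (K * S t)
        + K ^ 2 * (μ * L t))) t := by
    intro t
    have h := (hy t).fun_sub ((hSder t).const_mul (μ * K))
    rw [← hz₃] at h
    refine h.congr_deriv ?_
    have e1 : (ρe t - ρi t) / K = -(z₁ t + d * K * S t) := by rw [hz₁]; ring
    have e2 : y t = z₃ t + μ * K * S t := by rw [hz₃]; ring
    rw [e1, e2]
    linear_combination (Te / me * K) * hρe_eq t + K * S t * hde
  have hQ : ∀ t, 0 ≤ z₁ t ^ 2 + z₂ t ^ 2 + z₃ t ^ 2 + K ^ 2 * S t ^ 2 := fun t => by positivity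
  have hKS : ∀ t, (K * S t) ^ 2 = K ^ 2 * S t ^ 2 := fun t => mul_pow _ _ _
  have hLsq : ∀ t, L t ^ 2 ≤ C₁ * (z₁ t ^ 2 + z₂ t ^ 2 + z₃ t ^ 2 + K ^ 2 * S t ^ 2) := by
    intro t
    have h := hL 0 le_rfl zero_le_one (z₁ t) (z₂ t) (z₃ t) (K * S t)
    rw [hKS] at h
    refine le_trans (le_of_eq ?_) h
    rw [hLdef]
    ring
  intro t ht
  obtain ⟨k1, k2⟩ := key K hK hKr S δ z₁ z₂ z₃ _ _ _ _ hSder hδder hz₁der hz₂der hz₃der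
    (fun s => by
      have h := mul_le_mul_of_nonneg_left (hLsq s) (show 0 ≤ K ^ 6 by positivity)
      have h' := mul_nonneg (show 0 ≤ (C₂ + C₃ + C₄) * K ^ 6 by positivity) (hQ s)
      linear_combination h + h')
    (fun s => by
      have g1 := h₁ (K ^ 2) hK20 hK21 (z₁ s) (z₂ s) (z₃ s) (K * S s)
      have g2 := h₂ (K ^ 2) hK20 hK21 (z₁ s) (z₂ s) (z₃ s) (K * S s)
      have g3 := h₃ (K ^ 2) hK20 hK21 (z₁ s) (z₂ s) (z₃ s) (K * S s)
      rw [hKS] at g1 g2 g3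
      have i1 : (0 * z₁ s + 0 * z₂ s + 0 * z₃ s + d * μ * (K * S s) + K ^ 2 *
        (d * g * z₁ s + d * (μ * mi / M) * z₂ s + d * (μ * me / M) * z₃ s +
          d * (g * d + μ ^ 2 * (mi + me) / M) * (K * S s)))
        = d * μ * (K * S s) + K ^ 2 * (d * L s) := by rw [hLdef]; ring
      have i2 : (Ti / mi * be * z₁ s + Ti / M * z₂ s + Ti / mi * me / M * z₃ s +
        (Ti / mi * (be * d + μ * (mi + me) / M) + μ ^ 2) * (K * S s) + K ^ 2 *
        (μ * g * z₁ s + μ * (μ * mi / M) * z₂ s + μ * (μ * me / M) * z₃ s +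
          μ * (g * d + μ ^ 2 * (mi + me) / M) * (K * S s)))
        = Ti / mi * (be * z₁ s + mi / M * z₂ s + me / M * z₃ s
        + (be * d + μ * (mi + me) / M) * (K * S s)) + μ ^ 2 * (K * S s)
        + K ^ 2 * (μ * L s) := by rw [hLdef]; field_simp; ring
      have i3 : (-(Te / me * bi) * z₁ s + Te / me * mi / M * z₂ s + Te / M * z₃ s +
        (Te / me * (-(bi * d) + μ * (mi + me) / M) + μ ^ 2) * (K * S s) + K ^ 2 *
        (μ * g * z₁ s + μ * (μ * mi / M) * z₂ s + μ * (μ * me / M) * z₃ s +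
          μ * (g * d + μ ^ 2 * (mi + me) / M) * (K * S s)))
        = Te / me * (-bi * z₁ s + mi / M * z₂ s + me / M * z₃ s
        + (-(bi * d) + μ * (mi + me) / M) * (K * S s)) + μ ^ 2 * (K * S s)
        + K ^ 2 * (μ * L s) := by rw [hLdef]; field_simp; ring
      rw [i1] at g1
      rw [i2] at g2
      rw [i3] at g3
      have h := mul_le_mul_of_nonneg_left (add_le_add (add_le_add g1 g2) g3)
        (show 0 ≤ K ^ 4 by positivity)
      have h' := mul_nonneg (show 0 ≤ C₁ * K ^ 4 by positivity) (hQ s)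
      linear_combination h + h') t ht
  have hU0 : 0 ≤ U := by rw [hU]; positivity
  have hG0 : 0 ≤ G := by rw [hG]; positivity
  have bS : S 0 ^ 2 ≤ C₇ * U := by
    have h := hS0 K hK.le hK1 (ρi 0) (ρe 0) (x 0) (y 0)
    rw [← hU] at h
    refine le_trans (le_of_eq ?_) h
    rw [hS]
    ring
  have bδ : δ 0 ^ 2 ≤ K ^ 2 * (C₈ * U) := by
    have h := hδ0 0 le_rfl zero_le_one (ρi 0) (ρe 0) (x 0) (y 0)
    rw [← hU] at h
    refine le_trans (le_of_eq ?_) (mul_le_mul_of_nonneg_left h hK20)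
    simp only [hδ, hS, hr]
    norm_num
    ring
  have bn : z₁ 0 ^ 2 + z₂ 0 ^ 2 + z₃ 0 ^ 2
      ≤ 2 * (G + x 0 ^ 2 + y 0 ^ 2) + 2 * (d ^ 2 + 2 * μ ^ 2) * S 0 ^ 2 := by
    have := mul_le_mul_of_nonneg_right hK21
      (show 0 ≤ 2 * (d ^ 2 + 2 * μ ^ 2) * S 0 ^ 2 by positivity)
    rw [hG]
    simp only [hz₁, hz₂, hz₃]
    linarith [sq_nonneg ((ρi 0 - ρe 0) / K + d * K * S 0), sq_nonneg (x 0 + μ * K * S 0),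
      sq_nonneg (y 0 + μ * K * S 0)]
  have bS' := mul_le_mul_of_nonneg_left bS (show 0 ≤ 2 * (d ^ 2 + 2 * μ ^ 2) by positivity)
  have bx : x 0 ^ 2 + y 0 ^ 2 ≤ U := by
    rw [hU]
    linarith [sq_nonneg (ρi 0), sq_nonneg (ρe 0)]
  have bG : K ^ 2 * G ≤ 2 * U := by
    have : K ^ 2 * G = (ρi 0 - ρe 0) ^ 2 := by rw [hG]; field_simp
    rw [this, hU]
    linarith [sq_nonneg (ρi 0 + ρe 0), sq_nonneg (x 0), sq_nonneg (y 0)]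
  have hCU : 0 ≤ C₇ * U := by positivity
  have hCU' : 0 ≤ C₈ * U := by positivity
  have bnG : z₁ 0 ^ 2 + z₂ 0 ^ 2 + z₃ 0 ^ 2 ≤ B * (U + G) := by
    have : 0 ≤ (2 * (d ^ 2 + 2 * μ ^ 2 + 1) * C₇ + C₈) * G := by positivity
    rw [hBdef]
    linarith
  have bnK : K ^ 2 * (z₁ 0 ^ 2 + z₂ 0 ^ 2 + z₃ 0 ^ 2)
      ≤ (6 + 2 * (d ^ 2 + 2 * μ ^ 2) * C₇) * U := by
    have h := mul_le_mul_of_nonneg_left (bn.trans (add_le_add_right bS' _)) hK20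
    have h1 := mul_le_mul_of_nonneg_right hK21
      (show 0 ≤ 2 * (d ^ 2 + 2 * μ ^ 2) * (C₇ * U) by positivity)
    have h2 := mul_le_mul_of_nonneg_right hK21 (show 0 ≤ x 0 ^ 2 + y 0 ^ 2 by positivity)
    linarith
  have bΦ : δ 0 ^ 2 + K ^ 2 * S 0 ^ 2 + K ^ 4 * (z₁ 0 ^ 2 + z₂ 0 ^ 2 + z₃ 0 ^ 2)
      ≤ B * (K ^ 2 * U) := by
    have h := mul_le_mul_of_nonneg_left bnK hK20
    have h1 := mul_le_mul_of_nonneg_left bS hK20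
    have h2 : 0 ≤ K ^ 2 * (C₇ * U) := by positivity
    rw [hBdef]
    linarith
  have bnK' : K ^ 2 * (z₁ 0 ^ 2 + z₂ 0 ^ 2 + z₃ 0 ^ 2) ≤ B * U := by
    rw [hBdef]
    linarith
  obtain ⟨E, hE⟩ : ∃ E, E = Real.exp (-(lam * K ^ 2 * t)) := ⟨_, rfl⟩
  obtain ⟨E', hE'⟩ : ∃ E', E' = Real.exp (-(lam * t)) := ⟨_, rfl⟩
  have hE0 : 0 < E := by rw [hE]; positivity
  have hE'0 : 0 < E' := by rw [hE']; positivity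
  rw [← hE] at k1 k2 ⊢
  rw [← hE'] at k2 ⊢
  have s1 : δ t ^ 2 + K ^ 2 * S t ^ 2 ≤ C * B * (K ^ 2 * E * U) := by
    refine k1.trans ?_
    have := mul_le_mul_of_nonneg_left bΦ (show 0 ≤ C * E by positivity)
    linarith
  have s2 : z₁ t ^ 2 + z₂ t ^ 2 + z₃ t ^ 2
      ≤ C * B * (K ^ 4 * E * U + E' * (U + G)) := by
    refine k2.trans ?_
    have g1 := mul_le_mul_of_nonneg_left bΦ (show 0 ≤ C * E * K ^ 4 by positivity)
    have g2 := mul_le_mul_of_nonneg_left bnG (show 0 ≤ C * E' by positivity)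
    have g3 := mul_le_mul_of_nonneg_right hK21 (show 0 ≤ C * B * (K ^ 4 * E * U) by positivity)
    linarith
  have s3 : K ^ 2 * (z₁ t ^ 2 + z₂ t ^ 2 + z₃ t ^ 2)
      ≤ C * B * (K ^ 2 * E * U + E' * U) := by
    refine (mul_le_mul_of_nonneg_left k2 hK20).trans ?_
    have g1 := mul_le_mul_of_nonneg_left bΦ (show 0 ≤ C * E * K ^ 6 by positivity)
    have g2 := mul_le_mul_of_nonneg_left bnK' (show 0 ≤ C * E' by positivity)
    have g3 := mul_le_mul_of_nonneg_right (pow_le_one₀ (n := 6) hK.le hK1)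
      (show 0 ≤ C * B * (K ^ 2 * E * U) by positivity)
    linarith
  have s4 : K ^ 2 * δ t ^ 2 ≤ C * B * (K ^ 4 * E * U) := by
    have g1 := mul_le_mul_of_nonneg_left s1 hK20
    have g2 : 0 ≤ K ^ 2 * (K ^ 2 * S t ^ 2) := by positivity
    linarith
  obtain ⟨X, hX0, hX⟩ : ∃ X, 0 ≤ X ∧ X = C * (2 * B) *
    (K ^ 2 * E * U + E' * U) := ⟨_, by positivity, rfl⟩
  obtain ⟨Y, hY0, hY⟩ : ∃ Y, 0 ≤ Y ∧ Y = C * (2 * B) *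
    (K ^ 4 * E * U + E' * (U + G)) := ⟨_, by positivity, rfl⟩
  have t1 : δ t ^ 2 + K ^ 2 * S t ^ 2 + K ^ 2 * (z₁ t ^ 2 + z₂ t ^ 2 + z₃ t ^ 2) ≤ X := by
    have : 0 ≤ C * B * (E' * U) := by positivity
    rw [hX]
    linarith
  have t2 : z₁ t ^ 2 + z₂ t ^ 2 + z₃ t ^ 2 + K ^ 2 * δ t ^ 2 ≤ Y := by
    have : 0 ≤ C * B * (E' * (U + G)) := by positivity
    rw [hY]
    linarith
  have hrt : r t = S t - δ t := by rw [hδ]; ring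
  have fin1 : ∀ w v : ℝ, w - S t = K * v → ∀ c, 0 ≤ c → c ≤ C₅ + C₆ →
      v ^ 2 ≤ c * (z₁ t ^ 2 + z₂ t ^ 2 + z₃ t ^ 2 + K ^ 2 * S t ^ 2) →
      (w - r t) ^ 2 ≤ (2 + 2 * (C₅ + C₆) + 2 * μ ^ 2 + 2 * d ^ 2) * X := by
    intro w v hw c hc hcC hv
    have e1 : w - r t = δ t + K * v := by rw [hrt]; linarith
    have g1 := mul_le_mul_of_nonneg_left hv hK20
    have g2 := mul_le_mul_of_nonneg_right hK21
      (show 0 ≤ c * (K ^ 2 * S t ^ 2) by positivity)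
    have g3 : 0 ≤ c * δ t ^ 2 := by positivity
    have g4 := mul_le_mul_of_nonneg_left t1 hc
    have g5 := mul_le_mul_of_nonneg_right hcC hX0
    have g6 : 0 ≤ (2 * μ ^ 2 + 2 * d ^ 2) * X := by positivity
    have g7 : 0 ≤ K ^ 2 * S t ^ 2 + K ^ 2 * (z₁ t ^ 2 + z₂ t ^ 2 + z₃ t ^ 2) := by positivity
    rw [e1]
    linarith [sq_nonneg (δ t - K * v)]
  have fin2 : ∀ w z α : ℝ, z = w - α * K * S t → z ^ 2 ≤ z₁ t ^ 2 + z₂ t ^ 2 + z₃ t ^ 2 →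
      α ^ 2 ≤ μ ^ 2 + d ^ 2 →
      (w - α * K * r t) ^ 2 ≤ (2 + 2 * (C₅ + C₆) + 2 * μ ^ 2 + 2 * d ^ 2) * Y := by
    intro w z α hz hzn hα
    have e1 : w - α * K * r t = z + α * K * δ t := by rw [hrt, hz]; ring
    have g1 := mul_le_mul_of_nonneg_right hα (show 0 ≤ K ^ 2 * δ t ^ 2 by positivity)
    have g2 : K ^ 2 * δ t ^ 2 ≤ Y := by
      linarith [sq_nonneg (z₁ t), sq_nonneg (z₂ t), sq_nonneg (z₃ t)]
    have g3 : z ^ 2 ≤ Y := by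
      have : 0 ≤ K ^ 2 * δ t ^ 2 := by positivity
      linarith
    have g4 := mul_le_mul_of_nonneg_left g2 (show 0 ≤ μ ^ 2 + d ^ 2 by positivity)
    have g5 : 0 ≤ (C₅ + C₆) * Y := by positivity
    rw [e1]
    linarith [sq_nonneg (z - α * K * δ t)]
  have hμd : μ ^ 2 ≤ μ ^ 2 + d ^ 2 := by linarith [sq_nonneg d]
  rw [mul_assoc _ (C * (2 * B)), mul_assoc _ (C * (2 * B)), ← hX, ← hY]
  refine ⟨fin1 _ _ (by rw [sub_eq_iff_eq_add, add_comm]; exact hρi_eq t) C₅ hC₅.le (by linarith) ?_,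
    fin1 _ _ (by rw [sub_eq_iff_eq_add, add_comm]; exact hρe_eq t) C₆ hC₆.le (by linarith) ?_,
    fin2 _ (z₂ t) _ (by rw [hz₂]) ?_ hμd, fin2 _ (z₃ t) _ (by rw [hz₃]) ?_ hμd,
    fin2 _ (z₁ t) _ (by rw [hz₁]) ?_ (by linarith [sq_nonneg μ])⟩
  · have h := hρi' 0 le_rfl zero_le_one (z₁ t) (z₂ t) (z₃ t) (K * S t)
    rwa [hKS, zero_mul, add_zero] at h
  · have h := hρe' 0 le_rfl zero_le_one (z₁ t) (z₂ t) (z₃ t) (K * S t)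
    rwa [hKS, zero_mul, add_zero] at h
  · linarith [sq_nonneg (z₁ t), sq_nonneg (z₃ t)]
  · linarith [sq_nonneg (z₁ t), sq_nonneg (z₂ t)]
  · linarith [sq_nonneg (z₂ t), sq_nonneg (z₃ t)]

set_option maxHeartbeats 1000000 in
theorem exists_complex_system_decay {mi me νi νe Ti Te κ M μ d : ℝ}
    (hmi : 0 < mi) (hme : 0 < me) (hνi : 0 < νi) (hνe : 0 < νe)
    (hTi : 0 < Ti) (hTe : 0 < Te) (hκ : 0 < κ) (hM : M = mi * νi + me * νe)
    (hμ : μ * M = Ti + Te) (hd : d * (κ * M) = Te * (mi * νi) - Ti * (me * νe)) :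
    ∃ r₀ C lam : ℝ, 0 < r₀ ∧ 0 < C ∧ 0 < lam ∧ ∀ K : ℝ, 0 < K → K ≤ r₀ →
      ∀ ρi ρe x y : ℝ → ℂ,
      (∀ t, HasDerivAt ρi (-(K • x t)) t) →
      (∀ t, HasDerivAt ρe (-(K • y t)) t) →
      (∀ t, HasDerivAt x ((Ti / mi * K) • ρi t + (κ / mi / K) • (ρi t - ρe t) - νi • x t) t) →
      (∀ t, HasDerivAt y ((Te / me * K) • ρe t + (κ / me / K) • (ρe t - ρi t) - νe • y t) t) →
      ∀ r : ℝ → ℂ, (∀ t, r t = (Real.exp (-(μ * K ^ 2 * t)) / M) •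
        ((mi * νi) • ρi 0 + (me * νe) • ρe 0)) →
      ∀ U G : ℝ, 0 ≤ U → 0 ≤ G →
      U ^ 2 = normSq (ρi 0) + normSq (ρe 0) + normSq (x 0) + normSq (y 0) →
      G = ‖K⁻¹ • (ρi 0 - ρe 0)‖ →
      ∀ t, 0 ≤ t →
        ‖ρi t - r t‖ ≤
          C * (K * Real.exp (-(lam * K ^ 2 * t)) * U + Real.exp (-(lam * t)) * U) ∧
        ‖ρe t - r t‖ ≤
          C * (K * Real.exp (-(lam * K ^ 2 * t)) * U + Real.exp (-(lam * t)) * U) ∧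
        ‖x t - (μ * K) • r t‖ ≤
          C * (K ^ 2 * Real.exp (-(lam * K ^ 2 * t)) * U + Real.exp (-(lam * t)) * (U + G)) ∧
        ‖y t - (μ * K) • r t‖ ≤
          C * (K ^ 2 * Real.exp (-(lam * K ^ 2 * t)) * U + Real.exp (-(lam * t)) * (U + G)) ∧
        ‖K⁻¹ • (ρi t - ρe t) - (d * K) • r t‖ ≤
          C * (K ^ 2 * Real.exp (-(lam * K ^ 2 * t)) * U + Real.exp (-(lam * t)) * (U + G)) := by
  obtain ⟨r₀, C, lam, hr₀, hC, hlam, key⟩ :=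
    exists_real_system_decay hmi hme hνi hνe hTi hTe hκ hM hμ hd
  refine ⟨r₀, C + 1, lam / 2, hr₀, by positivity, by positivity, ?_⟩
  intro K hK hKr ρi ρe x y hρi hρe hx hy r hr U G hU0 hG0 hU hG t ht
  have proj : ∀ φ : ℂ →L[ℝ] ℝ, _ := fun φ => key K hK hKr
    (fun s => φ (ρi s)) (fun s => φ (ρe s)) (fun s => φ (x s)) (fun s => φ (y s))
    (fun s => (φ.hasFDerivAt.comp_hasDerivAt s (hρi s)).congr_deriv (by
      simp only [map_neg, map_smul, smul_eq_mul]))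
    (fun s => (φ.hasFDerivAt.comp_hasDerivAt s (hρe s)).congr_deriv (by
      simp only [map_neg, map_smul, smul_eq_mul]))
    (fun s => (φ.hasFDerivAt.comp_hasDerivAt s (hx s)).congr_deriv (by
      simp only [map_add, map_sub, map_smul, smul_eq_mul]
      ring))
    (fun s => (φ.hasFDerivAt.comp_hasDerivAt s (hy s)).congr_deriv (by
      simp only [map_add, map_sub, map_smul, smul_eq_mul]
      ring))
    (fun s => φ (r s)) (fun s => by
      simp only [hr, map_add, map_smul, smul_eq_mul]
      ring) _ _ rfl rfl t ht
  obtain ⟨a1, a2, a3, a4, a5⟩ := proj reCLM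
  obtain ⟨b1, b2, b3, b4, b5⟩ := proj imCLM
  simp only [reCLM_apply, imCLM_apply] at a1 a2 a3 a4 a5 b1 b2 b3 b4 b5
  have hU' : (ρi 0).re ^ 2 + (ρe 0).re ^ 2 + (x 0).re ^ 2 + (y 0).re ^ 2
      + ((ρi 0).im ^ 2 + (ρe 0).im ^ 2 + (x 0).im ^ 2 + (y 0).im ^ 2) = U ^ 2 := by
    rw [hU]
    simp only [normSq_apply]
    ring
  have hG' : (((ρi 0).re - (ρe 0).re) / K) ^ 2 + (((ρi 0).im - (ρe 0).im) / K) ^ 2 = G ^ 2 := by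
    rw [hG, ← normSq_eq_norm_sq, normSq_apply]
    simp only [smul_re, smul_im, sub_re, sub_im, smul_eq_mul]
    ring
  have half : ∀ s : ℝ, Real.exp (-(lam * s)) = Real.exp (-(lam / 2 * s)) ^ 2 := fun s => by
    rw [← Real.exp_nat_mul]
    congr 1
    push_cast
    ring
  simp only [mul_assoc lam (K ^ 2) t, mul_assoc (lam / 2) (K ^ 2) t] at a1 a2 a3 a4 a5 b1 b2 b3 b4 b5 ⊢
  simp only [half] at a1 a2 a3 a4 a5 b1 b2 b3 b4 b5
  have hE := Real.exp_pos (-(lam / 2 * (K ^ 2 * t)))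
  have hE' := Real.exp_pos (-(lam / 2 * t))
  generalize Real.exp (-(lam / 2 * (K ^ 2 * t))) = E at *
  generalize Real.exp (-(lam / 2 * t)) = E' at *
  have fin : ∀ (z : ℂ) (p q : ℝ), 0 ≤ p → 0 ≤ q →
      z.re ^ 2 + z.im ^ 2 ≤ C * (p ^ 2 + q ^ 2) → ‖z‖ ≤ (C + 1) * (p + q) := by
    intro z p q hp hq h
    refine abs_le_of_sq_le_sq' ?_ (by positivity) |>.2
    rw [← normSq_eq_norm_sq, normSq_apply]
    have h1 : C * (p ^ 2 + q ^ 2) ≤ (C + 1) ^ 2 * (p + q) ^ 2 := by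
      have h2 : p ^ 2 + q ^ 2 ≤ (p + q) ^ 2 := by linarith [mul_nonneg hp hq]
      have h3 : C ≤ (C + 1) ^ 2 := by linarith [sq_nonneg C]
      exact mul_le_mul h3 h2 (by positivity) (by positivity)
    linarith
  have hGU : 0 ≤ C * E' ^ 2 * (2 * (U * G)) := by positivity
  refine ⟨fin _ _ _ (by positivity) (by positivity) ?_,
    fin _ _ _ (by positivity) (by positivity) ?_,
    fin _ _ _ (by positivity) (by positivity) ?_,
    fin _ _ _ (by positivity) (by positivity) ?_,
    fin _ _ _ (by positivity) (by positivity) ?_⟩ <;>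
  simp only [smul_re, smul_im, sub_re, sub_im, smul_eq_mul]
  · linear_combination a1 + b1 + C * (K ^ 2 * E ^ 2 + E' ^ 2) * hU'
  · linear_combination a2 + b2 + C * (K ^ 2 * E ^ 2 + E' ^ 2) * hU'
  · linear_combination a3 + b3 + C * (K ^ 4 * E ^ 2 + E' ^ 2) * hU' + C * E' ^ 2 * hG' + hGU
  · linear_combination a4 + b4 + C * (K ^ 4 * E ^ 2 + E' ^ 2) * hU' + C * E' ^ 2 * hG' + hGU
  · linear_combination a5 + b5 + C * (K ^ 4 * E ^ 2 + E' ^ 2) * hU' + C * E' ^ 2 * hG' + hGU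

theorem hsq_const_mul (c : ℂ) (k : Fin 3 → ℝ) :
    hsq (fun j => c * (k j : ℂ)) = normSq c * ∑ j, k j ^ 2 := by
  simp only [hsq, map_mul, normSq_ofReal, Finset.mul_sum, sq]

theorem hnorm_const_mul (c : ℂ) (k : Fin 3 → ℝ) :
    hnorm (fun j => c * (k j : ℂ)) = ‖c‖ * Real.sqrt (∑ j, k j ^ 2) := by
  rw [hnorm, hsq_const_mul, Real.sqrt_mul (normSq_nonneg c), normSq_eq_norm_sq,
    Real.sqrt_sq (norm_nonneg c)]

theorem exists_longitudinal_amplitude {k : Fin 3 → ℝ} {K τ a ν : ℝ} (hK : 0 < K)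
    (hKk : ∑ j, k j ^ 2 = K ^ 2) {f g : ℝ → ℂ} {u : ℝ → Fin 3 → ℂ}
    (hu : Differentiable ℝ u) (hpar : ∀ t : ℝ, ∃ c : ℂ, ∀ j, u t j = c * (k j : ℂ))
    (hdu : ∀ (t : ℝ) (j : Fin 3), deriv u t j + (τ : ℂ) * (Complex.I * (k j : ℂ)) * f t
      + (a : ℂ) * (Complex.I * (k j : ℂ) / ((∑ i, (k i) ^ 2 : ℝ) : ℂ)) * g t
      + (ν : ℂ) * u t j = 0) :
    ∃ v : ℝ → ℂ, (∀ t, HasDerivAt v ((τ * K) • f t + (a / K) • g t - ν • v t) t) ∧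
      (∀ t, Complex.I * ∑ j, (k j : ℂ) * u t j = K • v t) ∧
      (∀ t j, u t j = -Complex.I / K * v t * (k j : ℂ)) := by
  have hKc : (K : ℂ) ≠ 0 := by exact_mod_cast hK.ne'
  have hkk : ∑ j, (k j : ℂ) * (k j : ℂ) = (K : ℂ) ^ 2 := by
    rw [← ofReal_pow, ← hKk]
    push_cast
    simp only [sq]
  refine ⟨fun t => Complex.I / K * ∑ j, (k j : ℂ) * u t j, fun t => ?_, fun t => ?_,
    fun t j => ?_⟩
  · have h : HasDerivAt (fun t => Complex.I / K * ∑ j, (k j : ℂ) * u t j)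
        (Complex.I / K * ∑ j, (k j : ℂ) * deriv u t j) t :=
      (HasDerivAt.fun_sum fun j _ =>
        ((hasDerivAt_pi.1 (hu t).hasDerivAt) j).const_mul (k j : ℂ)).const_mul _
    refine h.congr_deriv ?_
    have hd : ∑ j, (k j : ℂ) * deriv u t j = -Complex.I * (τ * K ^ 2 * f t + a * g t)
        - ν * ∑ j, (k j : ℂ) * u t j := by
      have hj : ∀ j, (k j : ℂ) * deriv u t j = (k j : ℂ) * (k j : ℂ) *
          (-Complex.I * (τ * f t + a / K ^ 2 * g t)) - ν * ((k j : ℂ) * u t j) := fun j => by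
        have := hdu t j
        rw [hKk, ofReal_pow] at this
        linear_combination (k j : ℂ) * this
      rw [Finset.sum_congr rfl fun j _ => hj j, Finset.sum_sub_distrib, ← Finset.sum_mul, hkk,
        ← Finset.mul_sum]
      field_simp
    rw [hd]
    simp only [real_smul]
    push_cast
    field_simp
    linear_combination -(τ * K ^ 2 * f t + a * g t) * I_sq
  · simp only [real_smul]
    field_simp
  · obtain ⟨c, hc⟩ := hpar t
    have hs : ∑ j, (k j : ℂ) * u t j = c * K ^ 2 := by
      rw [← hkk, Finset.mul_sum]
      exact Finset.sum_congr rfl fun j _ => by rw [hc j]; ring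
    beta_reduce
    rw [hs, hc j]
    field_simp
    linear_combination c * (k j : ℂ) * I_sq

/-- Low-frequency error estimates between the solution of the Fourier-transformed
longitudinal fluid system of the linearized two-fluid Euler–Maxwell system and the
diffusive Darcy profiles, assuming the zero-frequency cubic has three distinct roots. -/
theorem stmt_16 (mi me νi νe Ti Te e : ℝ)
    (hmi : 0 < mi) (hme : 0 < me) (hνi : 0 < νi) (hνe : 0 < νe)
    (hTi : 0 < Ti) (hTe : 0 < Te) (he : 0 < e)
    (hdisc : ∃ σ₂ σ₃ σ₄ : ℂ, σ₂ ≠ σ₃ ∧ σ₂ ≠ σ₄ ∧ σ₃ ≠ σ₄ ∧ ∀ z : ℂ,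
      z ^ 3 + ((νi + νe : ℝ) : ℂ) * z ^ 2
        + ((νi * νe + 4 * π * (e ^ 2 / mi + e ^ 2 / me) : ℝ) : ℂ) * z
        + ((4 * π * (e ^ 2 * νe / mi + e ^ 2 * νi / me) : ℝ) : ℂ)
        = (z - σ₂) * (z - σ₃) * (z - σ₄)) :
    ∃ r₀ C lam : ℝ, 0 < r₀ ∧ 0 < C ∧ 0 < lam ∧
      ∀ (k : Fin 3 → ℝ), k ≠ 0 → Real.sqrt (∑ j, (k j) ^ 2) ≤ r₀ →
      ∀ (ρi ρe : ℝ → ℂ) (ui ue : ℝ → Fin 3 → ℂ),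
        Differentiable ℝ ρi → Differentiable ℝ ρe →
        Differentiable ℝ ui → Differentiable ℝ ue →
        (∀ t : ℝ, ∃ a : ℂ, ∀ j, ui t j = a * (k j : ℂ)) →
        (∀ t : ℝ, ∃ a : ℂ, ∀ j, ue t j = a * (k j : ℂ)) →
        (∀ t : ℝ, deriv ρi t + Complex.I * ∑ j, (k j : ℂ) * ui t j = 0) →
        (∀ t : ℝ, deriv ρe t + Complex.I * ∑ j, (k j : ℂ) * ue t j = 0) →
        (∀ (t : ℝ) (j : Fin 3), deriv ui t j
          + ((Ti / mi : ℝ) : ℂ) * (Complex.I * (k j : ℂ)) * ρi t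
          + ((4 * π * e ^ 2 / mi : ℝ) : ℂ) *
              (Complex.I * (k j : ℂ) / ((∑ i, (k i) ^ 2 : ℝ) : ℂ)) * (ρi t - ρe t)
          + (νi : ℂ) * ui t j = 0) →
        (∀ (t : ℝ) (j : Fin 3), deriv ue t j
          + ((Te / me : ℝ) : ℂ) * (Complex.I * (k j : ℂ)) * ρe t
          + ((4 * π * e ^ 2 / me : ℝ) : ℂ) *
              (Complex.I * (k j : ℂ) / ((∑ i, (k i) ^ 2 : ℝ) : ℂ)) * (ρe t - ρi t)
          + (νe : ℂ) * ue t j = 0) →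
        (let ksq : ℝ := ∑ j, (k j) ^ 2
         let μ₁ : ℝ := (Ti + Te) / (mi * νi + me * νe)
         let U0 : ℝ := Real.sqrt (Complex.normSq (ρi 0) + Complex.normSq (ρe 0)
           + hsq (ui 0) + hsq (ue 0))
         let ρbar : ℝ → ℂ := fun t => Complex.exp (-((μ₁ * ksq * t : ℝ) : ℂ)) *
           (((mi * νi : ℝ) : ℂ) * ρi 0 + ((me * νe : ℝ) : ℂ) * ρe 0) /
             ((mi * νi + me * νe : ℝ) : ℂ)
         let ubar : ℝ → Fin 3 → ℂ := fun t j =>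
           -(μ₁ : ℂ) * (Complex.I * (k j : ℂ)) * ρbar t
         let Ebar : ℝ → Fin 3 → ℂ := fun t j =>
           (((Ti * me * νe - Te * mi * νi) / (e * (mi * νi + me * νe)) : ℝ) : ℂ) *
             (Complex.I * (k j : ℂ)) * ρbar t
         let Epar : ℝ → Fin 3 → ℂ := fun t j =>
           -(4 * (π : ℂ) * (e : ℂ) * (Complex.I * (k j : ℂ) / (ksq : ℂ)) * (ρi t - ρe t))
         ∀ t : ℝ, 0 ≤ t →
           (‖ρi t - ρbar t‖ ≤
              C * Real.sqrt ksq * Real.exp (-(lam * ksq * t)) * U0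
                + C * Real.exp (-(lam * t)) * U0) ∧
           (‖ρe t - ρbar t‖ ≤
              C * Real.sqrt ksq * Real.exp (-(lam * ksq * t)) * U0
                + C * Real.exp (-(lam * t)) * U0) ∧
           (hnorm (fun j => ui t j - ubar t j) ≤
              C * ksq * Real.exp (-(lam * ksq * t)) * U0
                + C * Real.exp (-(lam * t)) * (U0 + hnorm (Epar 0))) ∧
           (hnorm (fun j => ue t j - ubar t j) ≤
              C * ksq * Real.exp (-(lam * ksq * t)) * U0
                + C * Real.exp (-(lam * t)) * (U0 + hnorm (Epar 0))) ∧
           (hnorm (fun j => Epar t j - Ebar t j) ≤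
              C * ksq * Real.exp (-(lam * ksq * t)) * U0
                + C * Real.exp (-(lam * t)) * (U0 + hnorm (Epar 0)))) := by
  have hM0 : 0 < mi * νi + me * νe := by positivity
  have hp : 0 < 4 * π * e := by positivity
  obtain ⟨r₀, C, lam, hr₀, hC, hlam, key⟩ := exists_complex_system_decay
    (κ := 4 * π * e ^ 2) (M := mi * νi + me * νe)
    (μ := (Ti + Te) / (mi * νi + me * νe))
    (d := (Te * (mi * νi) - Ti * (me * νe)) / (4 * π * e ^ 2 * (mi * νi + me * νe)))
    hmi hme hνi hνe hTi hTe (by positivity) rfl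
    (div_mul_cancel₀ _ hM0.ne') (div_mul_cancel₀ _ (by positivity))
  refine ⟨r₀, (1 + 4 * π * e) * (1 + 1 / (4 * π * e)) * C, lam, hr₀, by positivity, hlam, ?_⟩
  intro k hk hkr ρi ρe ui ue dρi dρe dui due pui pue eρi eρe eui eue
  obtain ⟨K, hK⟩ : ∃ K, K = Real.sqrt (∑ j, k j ^ 2) := ⟨_, rfl⟩
  have hksq : 0 < ∑ j, k j ^ 2 := by
    obtain ⟨j, hj⟩ := Function.ne_iff.1 hk
    exact Finset.sum_pos' (fun i _ => sq_nonneg _) ⟨j, Finset.mem_univ j, by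
      have : k j ≠ 0 := hj
      positivity⟩
  have hK0 : 0 < K := by rw [hK]; exact Real.sqrt_pos.2 hksq
  have hKk : ∑ j, k j ^ 2 = K ^ 2 := by rw [hK, Real.sq_sqrt hksq.le]
  have hKc : (K : ℂ) ≠ 0 := by exact_mod_cast hK0.ne'
  obtain ⟨x, hx, xρ, xu⟩ := exists_longitudinal_amplitude hK0 hKk dui pui eui
  obtain ⟨y, hy, yρ, yu⟩ := exists_longitudinal_amplitude hK0 hKk due pue eue
  have hnx : ∀ z : ℂ, normSq (-Complex.I / K * z) * K ^ 2 = normSq z := fun z => by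
    rw [normSq_mul, normSq_div, normSq_neg, normSq_I, normSq_ofReal]
    field_simp
  have hux : ∀ (u : ℝ → Fin 3 → ℂ) (v : ℝ → ℂ),
      (∀ t j, u t j = -Complex.I / K * v t * (k j : ℂ)) → hsq (u 0) = normSq (v 0) := by
    intro u v h
    rw [show u 0 = fun j => -Complex.I / K * v 0 * (k j : ℂ) from funext (h 0),
      hsq_const_mul, hKk, hnx]
  have hnorm_dir : ∀ (α : ℝ) (z : ℂ), 0 ≤ α →
      hnorm (fun j => -Complex.I / K * (α * z) * (k j : ℂ)) = α * ‖z‖ := by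
    intro α z hα
    rw [hnorm_const_mul, ← hK, norm_mul, norm_div, norm_neg, norm_I, norm_mul, norm_real,
      norm_real, Real.norm_of_nonneg hα, Real.norm_of_nonneg hK0.le]
    field_simp
  intro ksq μ₁ U0 ρbar ubar Ebar Epar t ht
  have hksqK : ksq = K ^ 2 := hKk
  have hU0 : 0 ≤ U0 := Real.sqrt_nonneg _
  have hU2 : U0 ^ 2 = normSq (ρi 0) + normSq (ρe 0) + normSq (x 0) + normSq (y 0) := by
    rw [← hux ui x xu, ← hux ue y yu]
    refine Real.sq_sqrt ?_
    have h1 : 0 ≤ hsq (ui 0) := Finset.sum_nonneg fun _ _ => normSq_nonneg _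
    have h2 : 0 ≤ hsq (ue 0) := Finset.sum_nonneg fun _ _ => normSq_nonneg _
    have h3 := normSq_nonneg (ρi 0)
    have h4 := normSq_nonneg (ρe 0)
    positivity
  obtain ⟨k1, k2, k3, k4, k5⟩ := key K hK0 (hK ▸ hkr) ρi ρe x y
    (fun s => (dρi s).hasDerivAt.congr_deriv (by rw [← xρ]; linear_combination eρi s))
    (fun s => (dρe s).hasDerivAt.congr_deriv (by rw [← yρ]; linear_combination eρe s))
    hx hy ρbar (fun s => by
      simp only [ρbar, real_smul, hksqK, μ₁]
      push_cast
      ring) U0 _ hU0 (norm_nonneg _) hU2 rfl t ht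
  have hE0 : ∀ s, Epar s = fun j => -Complex.I / K *
      (((4 * π * e : ℝ) : ℂ) * (K⁻¹ • (ρi s - ρe s))) * (k j : ℂ) := fun s => funext fun j => by
    simp only [Epar, real_smul, hksqK]
    push_cast
    field_simp
  have hH : hnorm (Epar 0) = 4 * π * e * ‖K⁻¹ • (ρi 0 - ρe 0)‖ := by
    rw [hE0, hnorm_dir _ _ hp.le]
  have hui : hnorm (fun j => ui t j - ubar t j) = 1 * ‖x t - (μ₁ * K) • ρbar t‖ := by
    rw [← hnorm_dir _ _ zero_le_one]
    congr 1
    funext j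
    rw [xu]
    simp only [ubar, real_smul]
    push_cast
    field_simp
    ring
  have hue : hnorm (fun j => ue t j - ubar t j) = 1 * ‖y t - (μ₁ * K) • ρbar t‖ := by
    rw [← hnorm_dir _ _ zero_le_one]
    congr 1
    funext j
    rw [yu]
    simp only [ubar, real_smul]
    push_cast
    field_simp
    ring
  have hπ : (π : ℂ) ≠ 0 := by exact_mod_cast Real.pi_ne_zero
  have hec : (e : ℂ) ≠ 0 := by exact_mod_cast he.ne'
  have hMc : (mi * νi + me * νe : ℂ) ≠ 0 := by exact_mod_cast hM0.ne'
  have hEE : hnorm (fun j => Epar t j - Ebar t j) = 4 * π * e * ‖K⁻¹ • (ρi t - ρe t)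
      - ((Te * (mi * νi) - Ti * (me * νe)) / (4 * π * e ^ 2 * (mi * νi + me * νe)) * K)
        • ρbar t‖ := by
    rw [← hnorm_dir _ _ hp.le]
    congr 1
    funext j
    rw [hE0]
    simp only [Ebar, real_smul]
    push_cast
    field_simp
    ring
  rw [← hksqK] at k1 k2 k3 k4 k5
  have hexp := Real.exp_pos (-(lam * ksq * t))
  have hexp' := Real.exp_pos (-(lam * t))
  have hksq0 : 0 ≤ ksq := hksq.le
  have hKs : Real.sqrt ksq = K := hK.symm
  rw [hui, hue, hEE, hH, hKs]
  generalize Real.exp (-(lam * ksq * t)) = E at *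
  generalize Real.exp (-(lam * t)) = E' at *
  have hG : 0 ≤ ‖K⁻¹ • (ρi 0 - ρe 0)‖ := norm_nonneg _
  generalize ‖K⁻¹ • (ρi 0 - ρe 0)‖ = G at *
  generalize 4 * π * e = p at *
  have hpp : 0 < 1 / p := by positivity
  have hpinv : 1 / p * p = 1 := by field_simp
  have fin1 : ∀ X, X ≤ C * (K * E * U0 + E' * U0) →
      X ≤ (1 + p) * (1 + 1 / p) * C * K * E * U0 + (1 + p) * (1 + 1 / p) * C * E' * U0 := by
    intro X hX
    have h : 0 ≤ (1 + p + 1 / p) * (C * (K * E * U0 + E' * U0)) := by positivity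
    linear_combination hX + h - C * (K * E * U0 + E' * U0) * hpinv
  have fin2 : ∀ m X, 0 ≤ m → m ≤ 1 + p → X ≤ C * (ksq * E * U0 + E' * (U0 + G)) →
      m * X ≤ (1 + p) * (1 + 1 / p) * C * ksq * E * U0
        + (1 + p) * (1 + 1 / p) * C * E' * (U0 + p * G) := by
    intro m X hm hmp hX
    have h1 := mul_le_mul_of_nonneg_left hX hm
    have h2 := mul_le_mul_of_nonneg_right hmp
      (show 0 ≤ C * (ksq * E * U0 + E' * (U0 + G)) by positivity)
    have h3 : 0 ≤ (1 + p) * C * (1 / p * (ksq * E * U0 + E' * U0) + E' * (p * G)) := by positivity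
    linear_combination h1 + h2 + h3 - (1 + p) * C * E' * G * hpinv
  exact ⟨fin1 _ k1, fin1 _ k2, fin2 _ _ zero_le_one (by linarith) k3,
    fin2 _ _ zero_le_one (by linarith) k4, fin2 _ _ hp.le (by linarith) k5⟩
end

section
/- Let m_i, m_e, ν_i, ν_e, T_i, T_e, e, c > 0 with q_i = e, q_e = −e, set μ₁ = (T_i+T_e)/(m_iν_i+m_eν_e), and let r₀ > 0. Then there exist constants C, λ > 0 such that for every k ∈ ℝ³ with |k| ≥ r₀ and every solution (ρ̂_i, ρ̂_e, û_i, û_e, Ê, B̂) of the Fourier-transformed linearized two-fluid Euler–Maxwell system at frequency k, setting ρ̄̂(t) = e^{−μ₁|k|²t}(m_iν_i ρ̂_i(0)+m_eν_e ρ̂_e(0))/(m_iν_i+m_eν_e), ū̂(t) = −μ₁ (i k) ρ̄̂(t), Ē̂(t) = ((T_im_eν_e−T_em_iν_i)/(e(m_iν_i+m_eν_e))) (i k) ρ̄̂(t), one has for all t ≥ 0 and α = i,e: |ρ̂_α(t) − ρ̄̂(t)| ≤ C e^{−λ|k|^{-2}t}|Û(0)| + C e^{−λt}|(ρ̂_i(0),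 ρ̂_e(0))|; |û_α(t) − ū̂(t)| ≤ C e^{−λ|k|^{-2}t}|Û(0)| + C e^{−λt}|k||(ρ̂_i(0), ρ̂_e(0))|; and |Ê(t) − Ē̂(t)| ≤ C e^{−λ|k|^{-2}t}|Û(0)| + C e^{−λt}|k||(ρ̂_i(0), ρ̂_e(0))|. -/
open Real Complex

/-- Cross product on `ℂ³`. -/
def cross3 (u v : Fin 3 → ℂ) : Fin 3 → ℂ :=
  ![u 1 * v 2 - u 2 * v 1, u 2 * v 0 - u 0 * v 2, u 0 * v 1 - u 1 * v 0]

/-- The vector `i k` with components `i k_j`. -/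
def ikv (k : Fin 3 → ℝ) : Fin 3 → ℂ := fun j => Complex.I * (k j : ℂ)

/-- Real part of the Hermitian product on `ℂ`. -/
def cdot (a b : ℂ) : ℝ := a.re * b.re + a.im * b.im

/-- Real part of the Hermitian product on `ℂ³`. -/
def rdot (u v : Fin 3 → ℂ) : ℝ := ∑ j, cdot (u j) (v j)

/-- Fourier symbol of the divergence. -/
noncomputable def fdiv (k : Fin 3 → ℝ) (u : Fin 3 → ℂ) : ℂ := Complex.I * ∑ j, (k j : ℂ) * u j

/-- Fourier symbol of the gradient. -/
noncomputable def fgrad (k : Fin 3 → ℝ) (a : ℂ) : Fin 3 → ℂ := fun j => Complex.I * (k j : ℂ) * a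

/-- Fourier symbol of the curl. -/
noncomputable def fcurl (k : Fin 3 → ℝ) (u : Fin 3 → ℂ) : Fin 3 → ℂ := cross3 (ikv k) u

lemma cdot_self (a : ℂ) : cdot a a = normSq a := by
  simp [cdot, normSq_apply]

lemma rdot_self (u : Fin 3 → ℂ) : rdot u u = hsq u := by
  simp [rdot, hsq, cdot_self]

lemma rdot_comm (u v : Fin 3 → ℂ) : rdot u v = rdot v u := by
  simp only [rdot, cdot, Fin.sum_univ_three]; ring

lemma hsq_nonneg (u : Fin 3 → ℂ) : 0 ≤ hsq u :=
  Finset.sum_nonneg fun _ _ => normSq_nonneg _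

lemma rdot_fgrad (k : Fin 3 → ℝ) (a : ℂ) (u : Fin 3 → ℂ) :
    rdot u (fgrad k a) = -cdot (fdiv k u) a := by
  simp [rdot, cdot, fgrad, fdiv, Fin.sum_univ_three]; ring

lemma rdot_fcurl (k : Fin 3 → ℝ) (u v : Fin 3 → ℂ) :
    rdot u (fcurl k v) = rdot (fcurl k u) v := by
  simp [rdot, cdot, fcurl, cross3, ikv, Fin.sum_univ_three]; ring

lemma hsq_fgrad (k : Fin 3 → ℝ) (a : ℂ) :
    hsq (fgrad k a) = (∑ j, (k j) ^ 2) * normSq a := by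
  simp [hsq, fgrad, normSq_apply, Fin.sum_univ_three]; ring

lemma hsq_fcurl (k : Fin 3 → ℝ) (u : Fin 3 → ℂ) :
    hsq (fcurl k u) = (∑ j, (k j) ^ 2) * hsq u - normSq (fdiv k u) := by
  simp [hsq, fcurl, cross3, ikv, fdiv, normSq_apply, Fin.sum_univ_three]; ring

lemma normSq_fdiv_le (k : Fin 3 → ℝ) (u : Fin 3 → ℂ) :
    normSq (fdiv k u) ≤ (∑ j, (k j) ^ 2) * hsq u := by
  linarith [hsq_fcurl k u, hsq_nonneg (fcurl k u)]

lemma hsq_fcurl_le (k : Fin 3 → ℝ) (u : Fin 3 → ℂ) :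
    hsq (fcurl k u) ≤ (∑ j, (k j) ^ 2) * hsq u := by
  linarith [hsq_fcurl k u, normSq_nonneg (fdiv k u)]

lemma abs_mul_le_young {s t : ℝ} (hs : 0 < s) (hst : 1 ≤ 4 * s * t) (x y : ℝ) :
    |x * y| ≤ s * x ^ 2 + t * y ^ 2 := by
  have key : ∀ z : ℝ, z * y ≤ s * z ^ 2 + t * y ^ 2 := fun z => by
    have h : 0 ≤ 4 * s * (s * z ^ 2 + t * y ^ 2 - z * y) := by
      nlinarith [sq_nonneg (2 * s * z - y), mul_nonneg (sub_nonneg.2 hst) (sq_nonneg y)]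
    have := nonneg_of_mul_nonneg_right h (by positivity)
    linarith
  exact abs_le.2 ⟨by linarith [key (-x), neg_sq x], key x⟩

lemma abs_cdot_le {s t : ℝ} (hs : 0 < s) (hst : 1 ≤ 4 * s * t) (a b : ℂ) :
    |cdot a b| ≤ s * normSq a + t * normSq b := by
  have h₁ := abs_mul_le_young hs hst a.re b.re
  have h₂ := abs_mul_le_young hs hst a.im b.im
  have h₃ := abs_add_le (a.re * b.re) (a.im * b.im)
  simp only [cdot, normSq_apply]
  nlinarith

lemma abs_rdot_le {s t : ℝ} (hs : 0 < s) (hst : 1 ≤ 4 * s * t) (u v : Fin 3 → ℂ) :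
    |rdot u v| ≤ s * hsq u + t * hsq v := by
  simp only [rdot, hsq, Finset.mul_sum, ← Finset.sum_add_distrib]
  exact (Finset.abs_sum_le_sum_abs _ _).trans
    (Finset.sum_le_sum fun j _ => abs_cdot_le hs hst (u j) (v j))

lemma HasDerivAt.cdot {f g : ℝ → ℂ} {f' g' : ℂ} {t : ℝ} (hf : HasDerivAt f f' t)
    (hg : HasDerivAt g g' t) :
    HasDerivAt (fun s => cdot (f s) (g s)) (cdot f' (g t) + cdot (f t) g') t := by
  have hre {h : ℝ → ℂ} {h' : ℂ} (H : HasDerivAt h h' t) : HasDerivAt (fun s => (h s).re) h'.re t :=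
    Complex.reCLM.hasFDerivAt.comp_hasDerivAt t H
  have him {h : ℝ → ℂ} {h' : ℂ} (H : HasDerivAt h h' t) : HasDerivAt (fun s => (h s).im) h'.im t :=
    Complex.imCLM.hasFDerivAt.comp_hasDerivAt t H
  refine (((hre hf).mul (hre hg)).add ((him hf).mul (him hg))).congr_deriv ?_
  simp only [_root_.cdot]; ring

lemma HasDerivAt.rdot {f g : ℝ → Fin 3 → ℂ} {f' g' : Fin 3 → ℂ} {t : ℝ} (hf : HasDerivAt f f' t)
    (hg : HasDerivAt g g' t) :
    HasDerivAt (fun s => rdot (f s) (g s)) (rdot f' (g t) + rdot (f t) g') t := by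
  rw [hasDerivAt_pi] at hf hg
  refine (HasDerivAt.fun_sum fun j _ => (hf j).cdot (hg j)).congr_deriv ?_
  simp only [_root_.rdot, Finset.sum_add_distrib]

lemma HasDerivAt.fgrad (k : Fin 3 → ℝ) {f : ℝ → ℂ} {f' : ℂ} {t : ℝ} (hf : HasDerivAt f f' t) :
    HasDerivAt (fun s => fgrad k (f s)) (fgrad k f') t :=
  hasDerivAt_pi.2 fun _ => hf.const_mul _

lemma HasDerivAt.fcurl (k : Fin 3 → ℝ) {f : ℝ → Fin 3 → ℂ} {f' : Fin 3 → ℂ} {t : ℝ}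
    (hf : HasDerivAt f f' t) : HasDerivAt (fun s => fcurl k (f s)) (fcurl k f') t := by
  rw [hasDerivAt_pi] at hf ⊢
  intro j
  fin_cases j
  · exact ((hf 2).const_mul (ikv k 1)).sub ((hf 1).const_mul (ikv k 2))
  · exact ((hf 0).const_mul (ikv k 2)).sub ((hf 2).const_mul (ikv k 0))
  · exact ((hf 1).const_mul (ikv k 0)).sub ((hf 0).const_mul (ikv k 1))

/-- Testing the momentum equation of one fluid against a vector. -/
lemma rdot_momentum {m T q ν : ℝ} {k : Fin 3 → ℝ} {a : ℂ} {u u' E : Fin 3 → ℂ}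
    (h : ∀ j, (m : ℂ) * u' j + (T : ℂ) * (Complex.I * (k j : ℂ)) * a - (q : ℂ) * E j
      + (m : ℂ) * (ν : ℂ) * u j = 0) (v : Fin 3 → ℂ) :
    m * rdot u' v = T * cdot (fdiv k v) a + q * rdot E v - m * ν * rdot u v := by
  rw [← neg_neg (cdot _ _), ← rdot_fgrad, rdot_comm v]
  simp only [rdot, mul_neg, Finset.mul_sum, ← Finset.sum_add_distrib, ← Finset.sum_sub_distrib,
    ← Finset.sum_neg_distrib]
  refine Finset.sum_congr rfl fun j _ => ?_
  have hre := congrArg Complex.re (h j)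
  have him := congrArg Complex.im (h j)
  simp at hre him
  simp [cdot, fgrad]
  linear_combination (v j).re * hre + (v j).im * him

/-- Testing the Ampère equation against a vector. -/
lemma rdot_ampere {c e : ℝ} {k : Fin 3 → ℝ} {E' B ui ue : Fin 3 → ℂ}
    (h : ∀ j, E' j - (c : ℂ) * cross3 (ikv k) B j
      + 4 * (π : ℂ) * ((e : ℂ) * ui j - (e : ℂ) * ue j) = 0) (v : Fin 3 → ℂ) :
    rdot E' v = c * rdot (fcurl k B) v - 4 * π * e * (rdot ui v - rdot ue v) := by
  simp only [rdot, Finset.mul_sum, ← Finset.sum_sub_distrib]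
  refine Finset.sum_congr rfl fun j _ => ?_
  rw [← fcurl] at h
  have hre := congrArg Complex.re (h j)
  have him := congrArg Complex.im (h j)
  simp at hre him
  simp only [cdot]
  linear_combination (v j).re * hre + (v j).im * him

/-- Testing the Faraday equation against a vector. -/
lemma rdot_faraday {c : ℝ} {k : Fin 3 → ℝ} {B' E : Fin 3 → ℂ}
    (h : ∀ j, B' j + (c : ℂ) * cross3 (ikv k) E j = 0) (v : Fin 3 → ℂ) :
    rdot B' v = -c * rdot (fcurl k E) v := by
  simp only [rdot, Finset.mul_sum]
  refine Finset.sum_congr rfl fun j _ => ?_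
  rw [← fcurl] at h
  have hre := congrArg Complex.re (h j)
  have him := congrArg Complex.im (h j)
  simp at hre him
  simp only [cdot]
  linear_combination (v j).re * hre + (v j).im * him

lemma cdot_comm (a b : ℂ) : cdot a b = cdot b a := by
  simp only [cdot]; ring

lemma cdot_neg_right (a b : ℂ) : cdot a (-b) = -cdot a b := by
  simp [cdot]; ring

lemma cdot_neg_left (a b : ℂ) : cdot (-a) b = -cdot a b := by
  simp [cdot]; ring

/-- The linearized two-fluid Euler–Maxwell system at a fixed time and frequency; primes denote time
derivatives. -/
structure EulerMaxwellAt (mi me νi νe Ti Te e c : ℝ) (k : Fin 3 → ℝ) (ρi ρe ρi' ρe' : ℂ)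
    (ui ue E B ui' ue' E' B' : Fin 3 → ℂ) : Prop where
  mass_i : ρi' = -fdiv k ui
  mass_e : ρe' = -fdiv k ue
  momentum_i : ∀ j, (mi : ℂ) * ui' j + (Ti : ℂ) * (Complex.I * (k j : ℂ)) * ρi - (e : ℂ) * E j
    + (mi : ℂ) * (νi : ℂ) * ui j = 0
  momentum_e : ∀ j, (me : ℂ) * ue' j + (Te : ℂ) * (Complex.I * (k j : ℂ)) * ρe
    - ((-e : ℝ) : ℂ) * E j + (me : ℂ) * (νe : ℂ) * ue j = 0
  ampere : ∀ j, E' j - (c : ℂ) * cross3 (ikv k) B j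
    + 4 * (π : ℂ) * ((e : ℂ) * ui j - (e : ℂ) * ue j) = 0
  faraday : ∀ j, B' j + (c : ℂ) * cross3 (ikv k) E j = 0
  gauss : fdiv k E = 4 * (π : ℂ) * ((e : ℂ) * ρi - (e : ℂ) * ρe)
  solenoidal : fdiv k B = 0

namespace EulerMaxwellAt

variable {mi me νi νe Ti Te e c : ℝ} {k : Fin 3 → ℝ} {ρi ρe ρi' ρe' : ℂ}
  {ui ue E B ui' ue' E' B' : Fin 3 → ℂ}

lemma cdot_gauss (h : EulerMaxwellAt mi me νi νe Ti Te e c k ρi ρe ρi' ρe' ui ue E B ui' ue' E' B')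
    (a : ℂ) : cdot (fdiv k E) a = 4 * π * e * (cdot ρi a - cdot ρe a) := by
  rw [h.gauss]; simp [cdot]; ring

/-- The energy identity. -/
lemma energy (h : EulerMaxwellAt mi me νi νe Ti Te e c k ρi ρe ρi' ρe' ui ue E B ui' ue' E' B') :
    Ti * cdot ρi' ρi + Te * cdot ρe' ρe + mi * rdot ui' ui + me * rdot ue' ue
      + (4 * π)⁻¹ * (rdot E' E + rdot B' B) = -(mi * νi * hsq ui) - me * νe * hsq ue := by
  rw [rdot_momentum h.momentum_i, rdot_momentum h.momentum_e, rdot_ampere h.ampere,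
    rdot_faraday h.faraday, h.mass_i, h.mass_e, rdot_comm E ui, rdot_comm E ue,
    ← rdot_fcurl k E B, rdot_comm E (fcurl k B), rdot_self, rdot_self, cdot_neg_left, cdot_neg_left]
  have := Real.pi_ne_zero
  field_simp
  ring

/-- Dissipation of the densities. -/
lemma density_dissipation
    (h : EulerMaxwellAt mi me νi νe Ti Te e c k ρi ρe ρi' ρe' ui ue E B ui' ue' E' B')
    (hmi : 0 < mi) (hme : 0 < me) (hνi : 0 < νi) (hνe : 0 < νe) (hTi : 0 < Ti) (hTe : 0 < Te) :
    mi * (rdot ui' (fgrad k ρi) + rdot ui (fgrad k ρi'))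
      + me * (rdot ue' (fgrad k ρe) + rdot ue (fgrad k ρe'))
      ≤ (∑ j, (k j) ^ 2) * (-(Ti / 2 * normSq ρi) - Te / 2 * normSq ρe
          + mi * hsq ui + me * hsq ue)
        + (mi * νi) ^ 2 / (2 * Ti) * hsq ui + (me * νe) ^ 2 / (2 * Te) * hsq ue := by
  rw [mul_add, mul_add, rdot_momentum h.momentum_i, rdot_momentum h.momentum_e]
  simp only [rdot_fgrad, h.mass_i, h.mass_e, h.cdot_gauss, cdot_neg_right, cdot_self]
  have hdiv (a : ℂ) : cdot (fdiv k (fgrad k a)) a = -((∑ j, (k j) ^ 2) * normSq a) := by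
    rw [← hsq_fgrad, ← rdot_self, rdot_fgrad, neg_neg]
  have friction {m ν T : ℝ} (hm : 0 < m) (hν : 0 < ν) (hT : 0 < T) (u : Fin 3 → ℂ) (a : ℂ) :
      m * ν * cdot (fdiv k u) a
        ≤ (∑ j, (k j) ^ 2) * (T / 2 * normSq a) + (m * ν) ^ 2 / (2 * T) * hsq u := by
    have := abs_rdot_le (s := (m * ν) / (2 * T)) (t := T / (2 * (m * ν))) (by positivity)
      (by field_simp; norm_num) u (fgrad k a)
    rw [rdot_fgrad, abs_neg, hsq_fgrad] at this
    calc m * ν * cdot (fdiv k u) a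
        ≤ m * ν * (m * ν / (2 * T) * hsq u + T / (2 * (m * ν)) * ((∑ j, (k j) ^ 2) * normSq a)) :=
          mul_le_mul_of_nonneg_left ((le_abs_self _).trans this) (by positivity)
      _ = _ := by field_simp; ring
  have hi := friction hmi hνi hTi ui ρi
  have hee := friction hme hνe hTe ue ρe
  have hui := mul_le_mul_of_nonneg_left (normSq_fdiv_le k ui) hmi.le
  have hue := mul_le_mul_of_nonneg_left (normSq_fdiv_le k ue) hme.le
  have hsum : 0 ≤ 4 * π * e ^ 2 *
      (normSq ρi + normSq ρe - cdot ρe ρi - cdot ρi ρe) := by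
    refine mul_nonneg (by positivity) ?_
    simp only [normSq_apply, cdot]
    nlinarith [sq_nonneg (ρi.re - ρe.re), sq_nonneg (ρi.im - ρe.im)]
  simp only [hdiv]
  linarith

/-- Dissipation of the electric field. -/
lemma electric_dissipation
    (h : EulerMaxwellAt mi me νi νe Ti Te e c k ρi ρe ρi' ρe' ui ue E B ui' ue' E' B')
    (hmi : 0 < mi) (hνi : 0 < νi) (hTi : 0 < Ti) (he : 0 < e) (hc : 0 < c)
    (hk : 0 < ∑ j, (k j) ^ 2) :
    -(mi * (rdot ui' E + rdot ui E'))
      ≤ -(e / 2 * hsq E) + e / 16 * hsq B + 2 * π * e * Ti * (normSq ρi + normSq ρe)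
        + ((mi * νi) ^ 2 / (2 * e) + 6 * π * mi * e) * (hsq ui + hsq ue)
        + (∑ j, (k j) ^ 2) * (4 * (mi * c) ^ 2 / e * hsq ui) := by
  rw [mul_add, rdot_momentum h.momentum_i, rdot_comm ui E', rdot_ampere h.ampere, h.cdot_gauss,
    rdot_self, rdot_self, cdot_self, rdot_comm (fcurl k B)]
  have h₁ : mi * νi * rdot ui E ≤ (mi * νi) ^ 2 / (2 * e) * hsq ui + e / 2 * hsq E := by
    have := abs_rdot_le (s := (mi * νi) / (2 * e)) (t := e / (2 * (mi * νi))) (by positivity)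
      (by field_simp; norm_num) ui E
    calc _ ≤ mi * νi * ((mi * νi) / (2 * e) * hsq ui + e / (2 * (mi * νi)) * hsq E) :=
          mul_le_mul_of_nonneg_left ((le_abs_self _).trans this) (by positivity)
      _ = _ := by field_simp
  have h₂ : -(mi * c * rdot ui (fcurl k B))
      ≤ (∑ j, (k j) ^ 2) * (4 * (mi * c) ^ 2 / e * hsq ui) + e / 16 * hsq B := by
    have := abs_rdot_le (s := (∑ j, (k j) ^ 2) * (4 * (mi * c) / e))
      (t := (∑ j, (k j) ^ 2)⁻¹ * (e / (16 * (mi * c)))) (by positivity)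
      (by field_simp; norm_num) ui (fcurl k B)
    rw [hsq_fcurl, h.solenoidal, map_zero, sub_zero] at this
    rw [← mul_neg]
    refine (mul_le_mul_of_nonneg_left ((neg_le_abs _).trans this) (by positivity)).trans_eq ?_
    field_simp
  have h₃ := abs_rdot_le (s := 1 / 2) (t := 1 / 2) (by norm_num) (by norm_num) ue ui
  have h₄ := abs_cdot_le (s := 1 / 2) (t := 1 / 2) (by norm_num) (by norm_num) ρe ρi
  have h₅ : 4 * π * mi * e * (hsq ui - rdot ue ui) ≤ 4 * π * mi * e * (3 / 2 * (hsq ui + hsq ue)) :=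
    mul_le_mul_of_nonneg_left
      (by linarith [neg_le_abs (rdot ue ui), hsq_nonneg ui, hsq_nonneg ue]) (by positivity)
  have h₆ : 4 * π * e * Ti * (cdot ρe ρi - normSq ρi)
      ≤ 4 * π * e * Ti * (1 / 2 * (normSq ρi + normSq ρe)) :=
    mul_le_mul_of_nonneg_left
      (by linarith [le_abs_self (cdot ρe ρi), normSq_nonneg ρi, normSq_nonneg ρe]) (by positivity)
  have h₇ : 0 ≤ (mi * νi) ^ 2 / (2 * e) * hsq ue := mul_nonneg (by positivity) (hsq_nonneg ue)
  linarith

/-- Dissipation of the magnetic field. -/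
lemma magnetic_dissipation
    (h : EulerMaxwellAt mi me νi νe Ti Te e c k ρi ρe ρi' ρe' ui ue E B ui' ue' E' B')
    (he : 0 < e) (hc : 0 < c) :
    -(rdot E' (fcurl k B) + rdot E (fcurl k B'))
      ≤ (∑ j, (k j) ^ 2) * (-(c / 2 * hsq B) + c * hsq E)
        + 16 * (π * e) ^ 2 / c * (hsq ui + hsq ue) := by
  rw [rdot_ampere h.ampere, rdot_fcurl k E B', rdot_comm (fcurl k E), rdot_faraday h.faraday,
    rdot_self, rdot_self, hsq_fcurl k B, h.solenoidal, map_zero, sub_zero]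
  have hE := mul_le_mul_of_nonneg_left (hsq_fcurl_le k E) hc.le
  have current (u : Fin 3 → ℂ) : 4 * π * e * |rdot u (fcurl k B)|
      ≤ 16 * (π * e) ^ 2 / c * hsq u + c / 4 * ((∑ j, (k j) ^ 2) * hsq B) := by
    have := abs_rdot_le (s := 4 * (π * e) / c) (t := c / (16 * (π * e))) (by positivity)
      (by field_simp; norm_num) u (fcurl k B)
    rw [hsq_fcurl, h.solenoidal, map_zero, sub_zero] at this
    refine (mul_le_mul_of_nonneg_left this (by positivity)).trans_eq ?_
    field_simp
    ring
  have hpe : 0 ≤ 4 * π * e := by positivity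
  have hi := (mul_le_mul_of_nonneg_left (le_abs_self _) hpe).trans (current ui)
  have hee := (mul_le_mul_of_nonneg_left (neg_le_abs _) hpe).trans (current ue)
  linarith

end EulerMaxwellAt

/-- The squared norm of a state of the two-fluid Euler–Maxwell system. -/
noncomputable def stateSq (ρi ρe : ℂ) (ui ue E B : Fin 3 → ℂ) : ℝ :=
  normSq ρi + normSq ρe + hsq ui + hsq ue + hsq E + hsq B

/-- The physical energy. -/
noncomputable def energyFun (mi me Ti Te : ℝ) (ρi ρe : ℂ) (ui ue E B : Fin 3 → ℂ) : ℝ :=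
  2⁻¹ * (Ti * cdot ρi ρi + Te * cdot ρe ρe + mi * rdot ui ui + me * rdot ue ue
    + (4 * π)⁻¹ * (rdot E E + rdot B B))

/-- The cross terms of the Lyapunov functional, which recover the dissipation of the densities and
of the electromagnetic field. -/
noncomputable def crossFun (mi me e c θ : ℝ) (k : Fin 3 → ℝ) (ρi ρe : ℂ)
    (ui ue E B : Fin 3 → ℂ) : ℝ :=
  (∑ j, (k j) ^ 2) * (mi * rdot ui (fgrad k ρi) + me * rdot ue (fgrad k ρe))
    + θ * ((∑ j, (k j) ^ 2) * -(mi * rdot ui E) + e / (4 * c) * -rdot E (fcurl k B))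

/-- The time derivative of `crossFun`. -/
noncomputable def crossFunDeriv (mi me e c θ : ℝ) (k : Fin 3 → ℝ) (ρi ρe ρi' ρe' : ℂ)
    (ui ue E B ui' ue' E' B' : Fin 3 → ℂ) : ℝ :=
  (∑ j, (k j) ^ 2) * (mi * (rdot ui' (fgrad k ρi) + rdot ui (fgrad k ρi'))
      + me * (rdot ue' (fgrad k ρe) + rdot ue (fgrad k ρe')))
    + θ * ((∑ j, (k j) ^ 2) * -(mi * (rdot ui' E + rdot ui E'))
      + e / (4 * c) * -(rdot E' (fcurl k B) + rdot E (fcurl k B')))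

section Evolution

variable {mi me Ti Te e c θ t : ℝ} {k : Fin 3 → ℝ} {ρi ρe : ℝ → ℂ} {ui ue E B : ℝ → Fin 3 → ℂ}
  {ρi' ρe' : ℂ} {ui' ue' E' B' : Fin 3 → ℂ}

lemma hasDerivAt_energyFun (hρi : HasDerivAt ρi ρi' t) (hρe : HasDerivAt ρe ρe' t)
    (hui : HasDerivAt ui ui' t) (hue : HasDerivAt ue ue' t) (hE : HasDerivAt E E' t)
    (hB : HasDerivAt B B' t) :
    HasDerivAt (fun s => energyFun mi me Ti Te (ρi s) (ρe s) (ui s) (ue s) (E s) (B s))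
      (Ti * cdot ρi' (ρi t) + Te * cdot ρe' (ρe t) + mi * rdot ui' (ui t) + me * rdot ue' (ue t)
        + (4 * π)⁻¹ * (rdot E' (E t) + rdot B' (B t))) t := by
  refine (((((((hρi.cdot hρi).const_mul Ti).add ((hρe.cdot hρe).const_mul Te)).add
    ((hui.rdot hui).const_mul mi)).add ((hue.rdot hue).const_mul me)).add
    (((hE.rdot hE).add (hB.rdot hB)).const_mul (4 * π)⁻¹)).const_mul 2⁻¹).congr_deriv ?_
  rw [cdot_comm _ ρi', cdot_comm _ ρe', rdot_comm _ ui', rdot_comm _ ue', rdot_comm _ E',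
    rdot_comm _ B']
  ring

lemma hasDerivAt_crossFun (hρi : HasDerivAt ρi ρi' t) (hρe : HasDerivAt ρe ρe' t)
    (hui : HasDerivAt ui ui' t) (hue : HasDerivAt ue ue' t) (hE : HasDerivAt E E' t)
    (hB : HasDerivAt B B' t) :
    HasDerivAt (fun s => crossFun mi me e c θ k (ρi s) (ρe s) (ui s) (ue s) (E s) (B s))
      (crossFunDeriv mi me e c θ k (ρi t) (ρe t) ρi' ρe' (ui t) (ue t) (E t) (B t) ui' ue' E' B')
      t :=
  ((((hui.rdot (hρi.fgrad k)).const_mul mi).add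
    ((hue.rdot (hρe.fgrad k)).const_mul me)).const_mul _).add
    (((((hui.rdot hE).const_mul mi).neg.const_mul _).add
      ((hE.rdot (hB.fcurl k)).neg.const_mul _)).const_mul θ)

end Evolution

/-- The cross functional dissipates the densities and, with a loss of one power of `|k|²`, the
electromagnetic field. -/
lemma exists_crossFunDeriv_le {mi me νi νe Ti Te e c r : ℝ}
    (hmi : 0 < mi) (hme : 0 < me) (hνi : 0 < νi) (hνe : 0 < νe)
    (hTi : 0 < Ti) (hTe : 0 < Te) (he : 0 < e) (hc : 0 < c) (hr : 0 < r) :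
    ∃ θ a b A : ℝ, 0 < θ ∧ 0 < a ∧ 0 < b ∧ 0 < A ∧
      ∀ (k : Fin 3 → ℝ) (ρi ρe ρi' ρe' : ℂ) (ui ue E B ui' ue' E' B' : Fin 3 → ℂ),
        r ≤ ∑ j, (k j) ^ 2 →
        EulerMaxwellAt mi me νi νe Ti Te e c k ρi ρe ρi' ρe' ui ue E B ui' ue' E' B' →
        crossFunDeriv mi me e c θ k ρi ρe ρi' ρe' ui ue E B ui' ue' E' B'
          ≤ (∑ j, (k j) ^ 2) ^ 2 * (-(a * (normSq ρi + normSq ρe)) + A * (hsq ui + hsq ue))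
            - (∑ j, (k j) ^ 2) * (b * (hsq E + hsq B)) := by
  have hπ := Real.pi_pos
  obtain ⟨a, ha, hai, hae⟩ : ∃ a, 0 < a ∧ a ≤ Ti / 2 ∧ a ≤ Te / 2 :=
    ⟨min (Ti / 2) (Te / 2), by positivity, min_le_left _ _, min_le_right _ _⟩
  set β := (mi * νi) ^ 2 / (2 * Ti) + (me * νe) ^ 2 / (2 * Te) with hβ
  set γ := (mi * νi) ^ 2 / (2 * e) + 6 * π * mi * e
  set ζ := 4 * (mi * c) ^ 2 / e
  set ξ := e / (4 * c) * (16 * (π * e) ^ 2 / c) with hξ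
  set τ := 2 * π * e * Ti
  have hβ0 : 0 < β := by positivity
  have hγ0 : 0 < γ := by positivity
  have hζ0 : 0 < ζ := by positivity
  have hξ0 : 0 < ξ := by positivity
  have hτ0 : 0 < τ := by positivity
  set θ := a * r / (2 * τ) with hθ
  have hθ0 : 0 < θ := by positivity
  have hθτ : θ * (τ / r) = a / 2 := by rw [hθ]; field_simp
  refine ⟨θ, a / 2, θ * (e / 16), (mi + me + β / r) + θ * (γ / r + ζ + ξ / r ^ 2), hθ0,
    by positivity, by positivity, by positivity, ?_⟩
  intro k ρi ρe ρi' ρe' ui ue E B ui' ue' E' B' hk h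
  have hK : 0 < ∑ j, (k j) ^ 2 := hr.trans_le hk
  have h₁ := h.density_dissipation hmi hme hνi hνe hTi hTe
  have h₂ := h.electric_dissipation hmi hνi hTi he hc hK
  have h₃ := h.magnetic_dissipation he hc
  rw [crossFunDeriv]
  set K := ∑ j, (k j) ^ 2
  have nρi := normSq_nonneg ρi
  have nρe := normSq_nonneg ρe
  have nui := hsq_nonneg ui
  have nue := hsq_nonneg ue
  have nE := hsq_nonneg E
  have nB := hsq_nonneg B
  have hKr : 1 ≤ K / r := (one_le_div hr).2 hk
  have hKr2 : 1 ≤ K ^ 2 / r ^ 2 := by rw [← div_pow]; exact one_le_pow₀ hKr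
  have dens : mi * (rdot ui' (fgrad k ρi) + rdot ui (fgrad k ρi'))
      + me * (rdot ue' (fgrad k ρe) + rdot ue (fgrad k ρe'))
      ≤ K * (-(a * (normSq ρi + normSq ρe)) + (mi + me + β / r) * (hsq ui + hsq ue)) := by
    have e₁ : K * (a * normSq ρi) ≤ K * (Ti / 2 * normSq ρi) := by gcongr
    have e₂ : K * (a * normSq ρe) ≤ K * (Te / 2 * normSq ρe) := by gcongr
    have e₃ : (mi * νi) ^ 2 / (2 * Ti) * hsq ui + (me * νe) ^ 2 / (2 * Te) * hsq ue
        ≤ K / r * (β * (hsq ui + hsq ue)) := by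
      have : 0 ≤ (mi * νi) ^ 2 / (2 * Ti) * hsq ue := by positivity
      have : 0 ≤ (me * νe) ^ 2 / (2 * Te) * hsq ui := by positivity
      have : 0 ≤ β * (hsq ui + hsq ue) := by positivity
      refine le_trans ?_ (le_mul_of_one_le_left this hKr)
      rw [hβ]; linarith
    have e₄ : 0 ≤ K * (mi * hsq ue) := by positivity
    have e₅ : 0 ≤ K * (me * hsq ui) := by positivity
    have e₆ : K / r * (β * (hsq ui + hsq ue)) = K * (β / r * (hsq ui + hsq ue)) := by ring
    linarith
  have fields : K * -(mi * (rdot ui' E + rdot ui E'))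
      + e / (4 * c) * -(rdot E' (fcurl k B) + rdot E (fcurl k B'))
      ≤ -(K * (e / 16 * (hsq E + hsq B))) + K ^ 2 * (τ / r * (normSq ρi + normSq ρe)
        + (γ / r + ζ + ξ / r ^ 2) * (hsq ui + hsq ue)) := by
    have e₁ := mul_le_mul_of_nonneg_left h₂ hK.le
    have e₂ := mul_le_mul_of_nonneg_left h₃ (show 0 ≤ e / (4 * c) by positivity)
    have e₃ : e / (4 * c) * (K * (-(c / 2 * hsq B) + c * hsq E)
        + 16 * (π * e) ^ 2 / c * (hsq ui + hsq ue))
        = K * (-(e / 8 * hsq B) + e / 4 * hsq E) + ξ * (hsq ui + hsq ue) := by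
      rw [hξ]; field_simp; ring
    have e₄ : ξ * (hsq ui + hsq ue) ≤ K ^ 2 / r ^ 2 * (ξ * (hsq ui + hsq ue)) :=
      le_mul_of_one_le_left (by positivity) hKr2
    have e₅ : K * (τ * (normSq ρi + normSq ρe)) ≤ K / r * (K * (τ * (normSq ρi + normSq ρe))) :=
      le_mul_of_one_le_left (by positivity) hKr
    have e₆ : K * (γ * (hsq ui + hsq ue)) ≤ K / r * (K * (γ * (hsq ui + hsq ue))) :=
      le_mul_of_one_le_left (by positivity) hKr
    have e₇ : 0 ≤ K ^ 2 * (ζ * hsq ue) := by positivity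
    have e₈ : 0 ≤ K * (e * hsq E) := by positivity
    calc _ ≤ _ := add_le_add e₁ e₂
      _ ≤ _ := by
        rw [e₃]
        have : K ^ 2 / r ^ 2 * (ξ * (hsq ui + hsq ue)) = K ^ 2 * (ξ / r ^ 2 * (hsq ui + hsq ue)) := by
          ring
        have : K / r * (K * (τ * (normSq ρi + normSq ρe)))
            = K ^ 2 * (τ / r * (normSq ρi + normSq ρe)) := by ring
        have : K / r * (K * (γ * (hsq ui + hsq ue))) = K ^ 2 * (γ / r * (hsq ui + hsq ue)) := by
          ring
        linarith
  refine (add_le_add (mul_le_mul_of_nonneg_left dens hK.le)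
    (mul_le_mul_of_nonneg_left fields hθ0.le)).trans_eq ?_
  linear_combination K ^ 2 * (normSq ρi + normSq ρe) * hθτ

/-- The cross functional is controlled by the state. -/
lemma exists_abs_crossFun_le {mi me e c r θ : ℝ} (hmi : 0 < mi) (hme : 0 < me) (he : 0 < e)
    (hc : 0 < c) (hr : 0 < r) (hθ : 0 < θ) :
    ∃ M : ℝ, 0 < M ∧ ∀ (k : Fin 3 → ℝ) (ρi ρe : ℂ) (ui ue E B : Fin 3 → ℂ), r ≤ ∑ j, (k j) ^ 2 →
      |crossFun mi me e c θ k ρi ρe ui ue E B|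
        ≤ (∑ j, (k j) ^ 2) ^ 2 * (M * stateSq ρi ρe ui ue E B) := by
  refine ⟨(mi + me) * (1 / r + 1) + θ * (mi / r + e / (4 * c) * (1 / r ^ 2 + 1 / r)),
    by positivity, fun k ρi ρe ui ue E B hk => ?_⟩
  have young (u v : Fin 3 → ℂ) : |rdot u v| ≤ hsq u + hsq v := by
    simpa using abs_rdot_le (s := 1) (t := 1) one_pos (by norm_num) u v
  have hi := young ui (fgrad k ρi)
  have hee := young ue (fgrad k ρe)
  have hE := young ui E
  have hB := (young E (fcurl k B)).trans (add_le_add_right (hsq_fcurl_le k B) _)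
  rw [hsq_fgrad] at hi hee
  rw [crossFun]
  have nρi := normSq_nonneg ρi
  have nρe := normSq_nonneg ρe
  have nui := hsq_nonneg ui
  have nue := hsq_nonneg ue
  have nE := hsq_nonneg E
  have nB := hsq_nonneg B
  have hK : 0 < ∑ j, (k j) ^ 2 := hr.trans_le hk
  set K := ∑ j, (k j) ^ 2
  set S := stateSq ρi ρe ui ue E B with hS
  rw [stateSq] at hS
  have hS0 : 0 ≤ S := by rw [hS]; positivity
  have hKr : 1 ≤ K / r := (one_le_div hr).2 hk
  have hKr2 : 1 ≤ K ^ 2 / r ^ 2 := by rw [← div_pow]; exact one_le_pow₀ hKr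
  have scale {x y : ℝ} (hx : x ≤ S) (hy : y ≤ S) : x + K * y ≤ K * ((1 / r + 1) * S) := by
    have h₁ : S ≤ K / r * S := le_mul_of_one_le_left hS0 hKr
    have h₂ : K * y ≤ K * S := by gcongr
    have : K / r * S = K * (1 / r * S) := by ring
    linarith
  have hi' := hi.trans (scale (by linarith) (by linarith))
  have hee' := hee.trans (scale (by linarith) (by linarith))
  have hB' : |rdot E (fcurl k B)| ≤ K ^ 2 * ((1 / r ^ 2 + 1 / r) * S) := by
    have h₁ : S ≤ K ^ 2 / r ^ 2 * S := le_mul_of_one_le_left hS0 hKr2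
    have h₂ : K * hsq B ≤ K * S := by gcongr; linarith
    have h₃ : K * S ≤ K / r * (K * S) := le_mul_of_one_le_left (by positivity) hKr
    have h₄ : K ^ 2 / r ^ 2 * S + K / r * (K * S) = K ^ 2 * ((1 / r ^ 2 + 1 / r) * S) := by ring
    linarith
  have hE' : |rdot ui E| ≤ K * (1 / r * S) := by
    have h₁ : S ≤ K / r * S := le_mul_of_one_le_left hS0 hKr
    have : K / r * S = K * (1 / r * S) := by ring
    linarith
  calc |K * (mi * rdot ui (fgrad k ρi) + me * rdot ue (fgrad k ρe))
        + θ * (K * -(mi * rdot ui E) + e / (4 * c) * -rdot E (fcurl k B))|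
      ≤ K * (mi * |rdot ui (fgrad k ρi)| + me * |rdot ue (fgrad k ρe)|)
        + θ * (K * (mi * |rdot ui E|) + e / (4 * c) * |rdot E (fcurl k B)|) := by
        refine (abs_add_le _ _).trans (add_le_add ?_ ?_)
        · rw [abs_mul, abs_of_pos hK]
          refine mul_le_mul_of_nonneg_left ((abs_add_le _ _).trans_eq ?_) hK.le
          rw [abs_mul, abs_mul, abs_of_pos hmi, abs_of_pos hme]
        · rw [abs_mul, abs_of_pos hθ]
          refine mul_le_mul_of_nonneg_left ((abs_add_le _ _).trans_eq ?_) hθ.le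
          rw [abs_mul, abs_neg, abs_mul, abs_mul, abs_neg, abs_of_pos hmi, abs_of_pos hK,
            abs_of_pos (show 0 < e / (4 * c) by positivity)]
    _ ≤ K * (mi * (K * ((1 / r + 1) * S)) + me * (K * ((1 / r + 1) * S)))
        + θ * (K * (mi * (K * (1 / r * S)))
          + e / (4 * c) * (K ^ 2 * ((1 / r ^ 2 + 1 / r) * S))) := by gcongr
    _ = _ := by ring

/-- Grönwall's inequality for a differential inequality with constant rate. -/
lemma le_exp_mul_of_hasDerivAt_le {f f' : ℝ → ℝ} {b : ℝ} (hf : ∀ t, HasDerivAt f (f' t) t)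
    (hb : ∀ t, f' t ≤ -b * f t) {t : ℝ} (ht : 0 ≤ t) : f t ≤ Real.exp (-(b * t)) * f 0 := by
  have hg : ∀ s, HasDerivAt (fun s => Real.exp (b * s) * f s)
      (Real.exp (b * s) * (b * f s + f' s)) s := fun s => by
    refine ((((hasDerivAt_id s).const_mul b).exp).mul (hf s)).congr_deriv ?_
    simp; ring
  have hanti : Antitone fun s => Real.exp (b * s) * f s :=
    antitone_of_hasDerivAt_nonpos hg fun s =>
      mul_nonpos_of_nonneg_of_nonpos (Real.exp_pos _).le (by linarith [hb s])
  have h := hanti ht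
  simp only [mul_zero, Real.exp_zero, one_mul] at h
  rw [Real.exp_neg]
  rwa [← div_eq_inv_mul, le_div_iff₀' (Real.exp_pos _)]

/-- Decay of regularity-loss type for the two-fluid Euler–Maxwell system away from `k = 0`. -/
theorem exists_stateSq_decay {mi me νi νe Ti Te e c r : ℝ}
    (hmi : 0 < mi) (hme : 0 < me) (hνi : 0 < νi) (hνe : 0 < νe)
    (hTi : 0 < Ti) (hTe : 0 < Te) (he : 0 < e) (hc : 0 < c) (hr : 0 < r) :
    ∃ C lam : ℝ, 0 < C ∧ 0 < lam ∧
      ∀ (k : Fin 3 → ℝ) (ρi ρe ρi' ρe' : ℝ → ℂ) (ui ue E B ui' ue' E' B' : ℝ → Fin 3 → ℂ),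
        r ≤ ∑ j, (k j) ^ 2 →
        (∀ t, HasDerivAt ρi (ρi' t) t) → (∀ t, HasDerivAt ρe (ρe' t) t) →
        (∀ t, HasDerivAt ui (ui' t) t) → (∀ t, HasDerivAt ue (ue' t) t) →
        (∀ t, HasDerivAt E (E' t) t) → (∀ t, HasDerivAt B (B' t) t) →
        (∀ t, EulerMaxwellAt mi me νi νe Ti Te e c k (ρi t) (ρe t) (ρi' t) (ρe' t)
          (ui t) (ue t) (E t) (B t) (ui' t) (ue' t) (E' t) (B' t)) →
        ∀ t, 0 ≤ t → stateSq (ρi t) (ρe t) (ui t) (ue t) (E t) (B t)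
          ≤ C * Real.exp (-(lam * (∑ j, (k j) ^ 2)⁻¹ * t))
            * stateSq (ρi 0) (ρe 0) (ui 0) (ue 0) (E 0) (B 0) := by
  have hπ := Real.pi_pos
  obtain ⟨θ, a, b, A, hθ, ha, hb, hA, hcross⟩ :=
    exists_crossFunDeriv_le hmi hme hνi hνe hTi hTe he hc hr
  obtain ⟨M, hM, habs⟩ := exists_abs_crossFun_le hmi hme he hc hr hθ
  obtain ⟨μ, hμ, hμi, hμe⟩ : ∃ μ, 0 < μ ∧ μ ≤ mi * νi ∧ μ ≤ me * νe :=
    ⟨min (mi * νi) (me * νe), by positivity, min_le_left _ _, min_le_right _ _⟩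
  obtain ⟨m, hm, hm₁, hm₂, hm₃, hm₄, hm₅⟩ : ∃ m, 0 < m ∧ m ≤ 2⁻¹ * Ti ∧ m ≤ 2⁻¹ * Te ∧
      m ≤ 2⁻¹ * mi ∧ m ≤ 2⁻¹ * me ∧ m ≤ 2⁻¹ * (4 * π)⁻¹ :=
    ⟨min (2⁻¹ * Ti) (min (2⁻¹ * Te) (min (2⁻¹ * mi) (min (2⁻¹ * me) (2⁻¹ * (4 * π)⁻¹)))),
      by positivity, by simp, by simp, by simp, by simp, by simp⟩
  set N := Ti + Te + mi + me + (4 * π)⁻¹ with hN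
  have hN0 : 0 < N := by positivity
  obtain ⟨δ, hδ, hδA, hδM⟩ : ∃ δ, 0 < δ ∧ δ * A ≤ μ / 2 ∧ δ * M ≤ m / 2 := by
    refine ⟨min (μ / 2 / A) (m / 2 / M), by positivity, ?_, ?_⟩
    · rw [← le_div_iff₀ hA]; exact min_le_left _ _
    · rw [← le_div_iff₀ hM]; exact min_le_right _ _
  obtain ⟨κ, hκ, hκ₁, hκ₂, hκ₃⟩ : ∃ κ, 0 < κ ∧ κ ≤ r * (μ / 2) ∧ κ ≤ r * (δ * a) ∧ κ ≤ δ * b :=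
    ⟨min (r * (μ / 2)) (min (r * (δ * a)) (δ * b)), by positivity, by simp, by simp, by simp⟩
  refine ⟨(N + m / 2) / (m / 2), κ / (N + m / 2), by positivity, by positivity, ?_⟩
  intro k ρi ρe ρi' ρe' ui ue E B ui' ue' E' B' hk dρi dρe dui due dE dB sys t ht
  have hK : 0 < ∑ j, (k j) ^ 2 := hr.trans_le hk
  set K := ∑ j, (k j) ^ 2
  set S := fun t => stateSq (ρi t) (ρe t) (ui t) (ue t) (E t) (B t) with hS
  set L := fun t => K ^ 2 * energyFun mi me Ti Te (ρi t) (ρe t) (ui t) (ue t) (E t) (B t)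
    + δ * crossFun mi me e c θ k (ρi t) (ρe t) (ui t) (ue t) (E t) (B t) with hL
  have bounds (s : ℝ) : K ^ 2 * (m / 2 * S s) ≤ L s ∧ L s ≤ K ^ 2 * ((N + m / 2) * S s) := by
    have hc' := abs_le.1 (habs k (ρi s) (ρe s) (ui s) (ue s) (E s) (B s) hk)
    have nρi := normSq_nonneg (ρi s)
    have nρe := normSq_nonneg (ρe s)
    have nui := hsq_nonneg (ui s)
    have nue := hsq_nonneg (ue s)
    have nE := hsq_nonneg (E s)
    have nB := hsq_nonneg (B s)
    have hS0 : 0 ≤ S s := by simp only [hS, stateSq]; positivity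
    have en : m * S s ≤ energyFun mi me Ti Te (ρi s) (ρe s) (ui s) (ue s) (E s) (B s) ∧
        energyFun mi me Ti Te (ρi s) (ρe s) (ui s) (ue s) (E s) (B s) ≤ N * S s := by
      simp only [hS, stateSq, energyFun, cdot_self, rdot_self]
      have hp : 0 < (4 * π)⁻¹ := by positivity
      have up {w x : ℝ} (hw : 0 < w) (hwN : w ≤ N) (hx : 0 ≤ x) : 2⁻¹ * w * x ≤ N * x :=
        mul_le_mul_of_nonneg_right (by linarith) hx
      constructor
      · linarith [mul_le_mul_of_nonneg_right hm₁ nρi, mul_le_mul_of_nonneg_right hm₂ nρe,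
          mul_le_mul_of_nonneg_right hm₃ nui, mul_le_mul_of_nonneg_right hm₄ nue,
          mul_le_mul_of_nonneg_right hm₅ nE, mul_le_mul_of_nonneg_right hm₅ nB]
      · linarith [up hTi (by linarith) nρi, up hTe (by linarith) nρe, up hmi (by linarith) nui,
          up hme (by linarith) nue, up hp (by linarith) nE, up hp (by linarith) nB]
    have hK2 : 0 ≤ K ^ 2 := by positivity
    have c₁ : δ * (K ^ 2 * (M * S s)) ≤ K ^ 2 * (m / 2 * S s) := by
      have := mul_le_mul_of_nonneg_left (mul_le_mul_of_nonneg_right hδM hS0) hK2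
      linarith
    have c₂ := mul_le_mul_of_nonneg_left hc'.1 hδ.le
    have c₃ := mul_le_mul_of_nonneg_left hc'.2 hδ.le
    have c₄ := mul_le_mul_of_nonneg_left en.1 hK2
    have c₅ := mul_le_mul_of_nonneg_left en.2 hK2
    simp only [hL]
    constructor <;> linarith
  have dL (s : ℝ) := ((hasDerivAt_energyFun (mi := mi) (me := me) (Ti := Ti) (Te := Te) (dρi s)
    (dρe s) (dui s) (due s) (dE s) (dB s)).const_mul (K ^ 2)).add ((hasDerivAt_crossFun (mi := mi)
    (me := me) (e := e) (c := c) (θ := θ) (k := k) (dρi s) (dρe s) (dui s) (due s) (dE s)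
    (dB s)).const_mul δ)
  have decay := le_exp_mul_of_hasDerivAt_le (f := L) (b := κ / (N + m / 2) * K⁻¹) dL (fun s => by
    have hcr := mul_le_mul_of_nonneg_left (hcross k _ _ _ _ _ _ _ _ _ _ _ _ hk (sys s)) hδ.le
    rw [(sys s).energy]
    have nρi := normSq_nonneg (ρi s)
    have nρe := normSq_nonneg (ρe s)
    have nui := hsq_nonneg (ui s)
    have nue := hsq_nonneg (ue s)
    have nE := hsq_nonneg (E s)
    have nB := hsq_nonneg (B s)
    have key : κ / (N + m / 2) * K⁻¹ * L s ≤ K * (κ * S s) := by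
      calc _ ≤ κ / (N + m / 2) * K⁻¹ * (K ^ 2 * ((N + m / 2) * S s)) :=
            mul_le_mul_of_nonneg_left (bounds s).2 (by positivity)
        _ = _ := by field_simp
    have c₁ : K * (κ * (hsq (ui s) + hsq (ue s)))
        ≤ K * (K * (μ / 2) * (hsq (ui s) + hsq (ue s))) := by
      have : κ ≤ K * (μ / 2) := hκ₁.trans (by gcongr)
      gcongr
    have c₂ : K * (κ * (normSq (ρi s) + normSq (ρe s)))
        ≤ K * (K * (δ * a) * (normSq (ρi s) + normSq (ρe s))) := by
      have : κ ≤ K * (δ * a) := hκ₂.trans (by gcongr)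
      gcongr
    have c₃ : K * (κ * (hsq (E s) + hsq (B s))) ≤ K * (δ * b * (hsq (E s) + hsq (B s))) := by
      gcongr
    have c₄ : K ^ 2 * (δ * A * (hsq (ui s) + hsq (ue s)))
        ≤ K ^ 2 * (μ / 2 * (hsq (ui s) + hsq (ue s))) := by gcongr
    have c₅ : K ^ 2 * (μ * hsq (ui s)) ≤ K ^ 2 * (mi * νi * hsq (ui s)) := by gcongr
    have c₆ : K ^ 2 * (μ * hsq (ue s)) ≤ K ^ 2 * (me * νe * hsq (ue s)) := by gcongr
    simp only [hS, stateSq] at key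
    rw [neg_mul]
    linarith) ht
  have h₁ := (bounds t).1.trans (decay.trans
    (mul_le_mul_of_nonneg_left (bounds 0).2 (Real.exp_pos _).le))
  change S t ≤ _ * S 0
  have h₂ : 0 < K ^ 2 * (m / 2) := by positivity
  rw [← mul_assoc, ← le_div_iff₀' h₂] at h₁
  refine h₁.trans_eq ?_
  field_simp

lemma hnorm_eq_norm (v : Fin 3 → ℂ) : hnorm v = ‖WithLp.toLp 2 v‖ := by
  simp [hnorm, hsq, EuclideanSpace.norm_eq, normSq_eq_norm_sq]

lemma hnorm_sub_le (u v : Fin 3 → ℂ) : hnorm (fun j => u j - v j) ≤ hnorm u + hnorm v := by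
  simp only [hnorm_eq_norm]
  exact norm_sub_le (WithLp.toLp 2 u) (WithLp.toLp 2 v)

lemma hnorm_mul_fgrad (a : ℂ) (k : Fin 3 → ℝ) (z : ℂ) :
    hnorm (fun j => a * (Complex.I * (k j : ℂ)) * z) = ‖a‖ * √(∑ j, (k j) ^ 2) * ‖z‖ := by
  have h : (fun j => a * (Complex.I * (k j : ℂ)) * z) = fgrad k (a * z) := by
    funext j; simp only [fgrad]; ring
  rw [h, hnorm, hsq_fgrad, normSq_eq_norm_sq, Real.sqrt_mul' _ (sq_nonneg _),
    Real.sqrt_sq (norm_nonneg _), norm_mul]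
  ring

/-- A convex combination of two complex numbers is bounded by their joint Euclidean norm. -/
lemma norm_convex_combination_le {a b : ℝ} (ha : 0 < a) (hb : 0 < b) (x y : ℂ) :
    ‖((a : ℂ) * x + (b : ℂ) * y) / ((a + b : ℝ) : ℂ)‖ ≤ √(normSq x + normSq y) := by
  have hab : 0 < a + b := by positivity
  have hx : ‖x‖ ≤ √(normSq x + normSq y) :=
    Real.le_sqrt_of_sq_le (by rw [← normSq_eq_norm_sq]; linarith [normSq_nonneg y])
  have hy : ‖y‖ ≤ √(normSq x + normSq y) :=
    Real.le_sqrt_of_sq_le (by rw [← normSq_eq_norm_sq]; linarith [normSq_nonneg x])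
  rw [norm_div, norm_real, Real.norm_of_nonneg hab.le, div_le_iff₀ hab]
  calc _ ≤ ‖(a : ℂ) * x‖ + ‖(b : ℂ) * y‖ := norm_add_le _ _
    _ = a * ‖x‖ + b * ‖y‖ := by
      rw [norm_mul, norm_mul, norm_real, norm_real, Real.norm_of_nonneg ha.le,
        Real.norm_of_nonneg hb.le]
    _ ≤ a * √(normSq x + normSq y) + b * √(normSq x + normSq y) := by gcongr
    _ = _ := by ring

/-- High-frequency (`|k| ≥ r₀`) error estimates between the solution of the
Fourier-transformed linearized two-fluid Euler–Maxwell system and the diffusive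
Darcy profiles of the fluid part. -/
theorem stmt_17 (mi me νi νe Ti Te e c : ℝ)
    (hmi : 0 < mi) (hme : 0 < me) (hνi : 0 < νi) (hνe : 0 < νe)
    (hTi : 0 < Ti) (hTe : 0 < Te) (he : 0 < e) (hc : 0 < c)
    (r₀ : ℝ) (hr₀ : 0 < r₀) :
    ∃ C lam : ℝ, 0 < C ∧ 0 < lam ∧
      ∀ (k : Fin 3 → ℝ), r₀ ≤ Real.sqrt (∑ j, (k j) ^ 2) →
      ∀ (ρi ρe : ℝ → ℂ) (ui ue E B : ℝ → Fin 3 → ℂ),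
        Differentiable ℝ ρi → Differentiable ℝ ρe →
        Differentiable ℝ ui → Differentiable ℝ ue →
        Differentiable ℝ E → Differentiable ℝ B →
        (∀ t : ℝ, deriv ρi t + Complex.I * ∑ j, (k j : ℂ) * ui t j = 0) →
        (∀ t : ℝ, deriv ρe t + Complex.I * ∑ j, (k j : ℂ) * ue t j = 0) →
        (∀ (t : ℝ) (j : Fin 3), (mi : ℂ) * deriv ui t j
          + (Ti : ℂ) * (Complex.I * (k j : ℂ)) * ρi t
          - (e : ℂ) * E t j + (mi : ℂ) * (νi : ℂ) * ui t j = 0) →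
        (∀ (t : ℝ) (j : Fin 3), (me : ℂ) * deriv ue t j
          + (Te : ℂ) * (Complex.I * (k j : ℂ)) * ρe t
          + (e : ℂ) * E t j + (me : ℂ) * (νe : ℂ) * ue t j = 0) →
        (∀ (t : ℝ) (j : Fin 3), deriv E t j - (c : ℂ) * cross3 (ikv k) (B t) j
          + 4 * (π : ℂ) * ((e : ℂ) * ui t j - (e : ℂ) * ue t j) = 0) →
        (∀ (t : ℝ) (j : Fin 3), deriv B t j + (c : ℂ) * cross3 (ikv k) (E t) j = 0) →
        (∀ t : ℝ, Complex.I * ∑ j, (k j : ℂ) * E t j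
          = 4 * (π : ℂ) * ((e : ℂ) * ρi t - (e : ℂ) * ρe t)) →
        (∀ t : ℝ, Complex.I * ∑ j, (k j : ℂ) * B t j = 0) →
        (let ksq : ℝ := ∑ j, (k j) ^ 2
         let μ₁ : ℝ := (Ti + Te) / (mi * νi + me * νe)
         let U0 : ℝ := Real.sqrt (Complex.normSq (ρi 0) + Complex.normSq (ρe 0)
           + hsq (ui 0) + hsq (ue 0) + hsq (E 0) + hsq (B 0))
         let R0 : ℝ := Real.sqrt (Complex.normSq (ρi 0) + Complex.normSq (ρe 0))
         let ρbar : ℝ → ℂ := fun t => Complex.exp (-((μ₁ * ksq * t : ℝ) : ℂ)) *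
           (((mi * νi : ℝ) : ℂ) * ρi 0 + ((me * νe : ℝ) : ℂ) * ρe 0) /
             ((mi * νi + me * νe : ℝ) : ℂ)
         let ubar : ℝ → Fin 3 → ℂ := fun t j =>
           -(μ₁ : ℂ) * (Complex.I * (k j : ℂ)) * ρbar t
         let Ebar : ℝ → Fin 3 → ℂ := fun t j =>
           (((Ti * me * νe - Te * mi * νi) / (e * (mi * νi + me * νe)) : ℝ) : ℂ) *
             (Complex.I * (k j : ℂ)) * ρbar t
         ∀ t : ℝ, 0 ≤ t →
           (‖ρi t - ρbar t‖ ≤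
              C * Real.exp (-(lam * ksq⁻¹ * t)) * U0 + C * Real.exp (-(lam * t)) * R0) ∧
           (‖ρe t - ρbar t‖ ≤
              C * Real.exp (-(lam * ksq⁻¹ * t)) * U0 + C * Real.exp (-(lam * t)) * R0) ∧
           (hnorm (fun j => ui t j - ubar t j) ≤
              C * Real.exp (-(lam * ksq⁻¹ * t)) * U0
                + C * Real.exp (-(lam * t)) * Real.sqrt ksq * R0) ∧
           (hnorm (fun j => ue t j - ubar t j) ≤
              C * Real.exp (-(lam * ksq⁻¹ * t)) * U0
                + C * Real.exp (-(lam * t)) * Real.sqrt ksq * R0) ∧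
           (hnorm (fun j => E t j - Ebar t j) ≤
              C * Real.exp (-(lam * ksq⁻¹ * t)) * U0
                + C * Real.exp (-(lam * t)) * Real.sqrt ksq * R0)) := by
  obtain ⟨C₀, lam₀, hC₀, hlam₀, hdecay⟩ :=
    exists_stateSq_decay hmi hme hνi hνe hTi hTe he hc (r := r₀ ^ 2) (by positivity)
  have hμ : 0 < (Ti + Te) / (mi * νi + me * νe) := by positivity
  set μ := (Ti + Te) / (mi * νi + me * νe)
  set γ := (Ti * me * νe - Te * mi * νi) / (e * (mi * νi + me * νe))
  obtain ⟨lam, hlam, hlam₁, hlam₂⟩ : ∃ lam, 0 < lam ∧ lam ≤ lam₀ / 2 ∧ lam ≤ μ * r₀ ^ 2 :=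
    ⟨min (lam₀ / 2) (μ * r₀ ^ 2), by positivity, min_le_left _ _, min_le_right _ _⟩
  refine ⟨√C₀ + 1 + μ + |γ|, lam, by positivity, hlam, ?_⟩
  intro k hk ρi ρe ui ue E B dρi dρe dui due dE dB massi masse momi mome amp far gau sol
    ksq μ₁ U0 R0 ρbar ubar Ebar t ht
  have hk' : r₀ ^ 2 ≤ ksq := (Real.le_sqrt' hr₀).1 hk
  have hksq : 0 < ksq := lt_of_lt_of_le (by positivity) hk'
  have hS := hdecay k ρi ρe (deriv ρi) (deriv ρe) ui ue E B (deriv ui) (deriv ue) (deriv E)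
    (deriv B) hk' (fun t => (dρi t).hasDerivAt) (fun t => (dρe t).hasDerivAt)
    (fun t => (dui t).hasDerivAt) (fun t => (due t).hasDerivAt) (fun t => (dE t).hasDerivAt)
    (fun t => (dB t).hasDerivAt)
    (fun t => ⟨eq_neg_of_add_eq_zero_left (massi t), eq_neg_of_add_eq_zero_left (masse t), momi t,
      fun j => by rw [← mome t j]; push_cast; ring, amp t, far t, gau t, sol t⟩) t ht
  have hU0 : 0 ≤ U0 := Real.sqrt_nonneg _
  have hR0 : 0 ≤ R0 := Real.sqrt_nonneg _
  have hsol {x : ℝ} (hx : x ≤ stateSq (ρi t) (ρe t) (ui t) (ue t) (E t) (B t)) :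
      √x ≤ √C₀ * Real.exp (-(lam * ksq⁻¹ * t)) * U0 := by
    have h₁ : √x ≤ √(C₀ * Real.exp (-(lam₀ * ksq⁻¹ * t))
        * stateSq (ρi 0) (ρe 0) (ui 0) (ue 0) (E 0) (B 0)) := Real.sqrt_le_sqrt (hx.trans hS)
    rw [Real.sqrt_mul (by positivity), Real.sqrt_mul hC₀.le, ← Real.exp_half] at h₁
    refine h₁.trans ?_
    change _ * U0 ≤ _
    have h₂ : lam * (ksq⁻¹ * t) ≤ lam₀ / 2 * (ksq⁻¹ * t) := by gcongr
    gcongr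
    linarith
  have nρi := normSq_nonneg (ρi t)
  have nρe := normSq_nonneg (ρe t)
  have nui := hsq_nonneg (ui t)
  have nue := hsq_nonneg (ue t)
  have nE := hsq_nonneg (E t)
  have nB := hsq_nonneg (B t)
  have hnormSq (z : ℂ) : ‖z‖ = √(normSq z) := by
    rw [normSq_eq_norm_sq, Real.sqrt_sq (norm_nonneg _)]
  have hρbar : ‖ρbar t‖ ≤ Real.exp (-(lam * t)) * R0 := by
    change ‖Complex.exp _ * _ / _‖ ≤ _
    rw [mul_div_assoc, norm_mul, Complex.norm_exp]
    refine mul_le_mul ?_ (norm_convex_combination_le (by positivity) (by positivity) _ _)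
      (norm_nonneg _) (Real.exp_pos _).le
    rw [← ofReal_neg, ofReal_re]
    have h₁ : μ * r₀ ^ 2 ≤ μ * ksq := by gcongr
    have h₂ : lam * t ≤ μ * ksq * t := by gcongr; linarith
    exact Real.exp_le_exp.2 (neg_le_neg h₂)
  have hubar : hnorm (ubar t) ≤ μ * (Real.exp (-(lam * t)) * √ksq * R0) := by
    refine (hnorm_mul_fgrad _ k _).trans_le ?_
    rw [norm_neg, norm_real, Real.norm_of_nonneg hμ.le]
    calc μ * √ksq * ‖ρbar t‖ ≤ μ * √ksq * (Real.exp (-(lam * t)) * R0) := by gcongr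
      _ = _ := by ring
  have hEbar : hnorm (Ebar t) ≤ |γ| * (Real.exp (-(lam * t)) * √ksq * R0) := by
    refine (hnorm_mul_fgrad _ k _).trans_le ?_
    rw [norm_real, Real.norm_eq_abs]
    calc |γ| * √ksq * ‖ρbar t‖ ≤ |γ| * √ksq * (Real.exp (-(lam * t)) * R0) := by gcongr
      _ = _ := by ring
  have combine {x y a w : ℝ} (hx : x ≤ √C₀ * Real.exp (-(lam * ksq⁻¹ * t)) * U0)
      (hy : y ≤ a * w) (hw : 0 ≤ w) (ha : a ≤ √C₀ + 1 + μ + |γ|) :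
      x + y ≤ (√C₀ + 1 + μ + |γ|) * Real.exp (-(lam * ksq⁻¹ * t)) * U0
        + (√C₀ + 1 + μ + |γ|) * w := by
    refine add_le_add (hx.trans ?_) (hy.trans (by gcongr))
    gcongr
    linarith [abs_nonneg γ]
  have hsC := Real.sqrt_nonneg C₀
  have hγ0 := abs_nonneg γ
  have hw : 0 ≤ Real.exp (-(lam * t)) * √ksq * R0 := by positivity
  have hwρ : 0 ≤ Real.exp (-(lam * t)) * R0 := by positivity
  rw [← one_mul (_ * R0)] at hρbar
  simp only [mul_assoc _ (Real.exp (-(lam * t))), mul_assoc _ (Real.exp (-(lam * t)) * √ksq)]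
  refine ⟨?_, ?_, ?_, ?_, ?_⟩
  · refine (norm_sub_le _ _).trans (combine ?_ hρbar hwρ (by linarith))
    rw [hnormSq]; exact hsol (by simp only [stateSq]; linarith)
  · refine (norm_sub_le _ _).trans (combine ?_ hρbar hwρ (by linarith))
    rw [hnormSq]; exact hsol (by simp only [stateSq]; linarith)
  · exact (hnorm_sub_le _ _).trans
      (combine (hsol (by simp only [stateSq]; linarith)) hubar hw (by linarith))
  · exact (hnorm_sub_le _ _).trans
      (combine (hsol (by simp only [stateSq]; linarith)) hubar hw (by linarith))
  · exact (hnorm_sub_le _ _).trans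
      (combine (hsol (by simp only [stateSq]; linarith)) hEbar hw (by linarith))
end
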